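/- arXiv:2512.03223 — 11 statements merged into one kernel-verified Lean document; each statement's English description precedes it below -/
import Mathlib

section
/- Let L ⊆ M be skew fields over k. Assume that M is generated as a skew field over k by m ≥ 1 elements, and that d := dim M_L, the dimension of M as a right L-vector space, is finite. Then L is generated as a skew field over k by at most d²(m−1)+d elements. -/
open Module in
/-- triangularity: coefficients vanish. -/
lemma skew_coeff_zero {D V : Type*} [DivisionRing D] [AddCommGroup V] [Module D V]
    (T : V →ₗ[D] V) (f : V →ₗ[D] D) (u : V) (n : ℕ)
    (h0 : ∀ i < n, f ((T ^ i) u) = 0) (h1 : f ((T ^ n) u) ≠ 0)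
    (c : Fin (n + 1) → D)
    (hc : ∀ i < n + 1, f ((T ^ i) (∑ j : Fin (n + 1), c j • (T ^ (j : ℕ)) u)) = 0) :
    ∀ j, c j = 0 := by
  have key : ∀ s : ℕ, ∀ j : Fin (n + 1), n - (j : ℕ) = s → c j = 0 := by
    intro s
    induction s using Nat.strong_induction_on with
    | _ s ih =>
      intro j hj
      have hjl := j.2
      have h := hc (n - j) (by omega)
      rw [map_sum, map_sum, Finset.sum_eq_single j] at h
      · rw [map_smul, map_smul, ← Module.End.mul_apply, ← pow_add] at h
        rw [show n - (j : ℕ) + j = n by omega] at h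
        simpa [h1] using h
      · intro i _ hij
        have hil := i.2
        rw [map_smul, map_smul, ← Module.End.mul_apply, ← pow_add]
        rcases lt_or_gt_of_ne (fun h => hij (Fin.ext h) : (i : ℕ) ≠ j) with hlt | hgt
        · rw [h0 _ (by omega), smul_zero]
        · rw [ih (n - i) (by omega) i rfl, zero_smul]
      · simp
  exact fun j => key _ j rfl

open Module in
/-- Rational canonical form over a division ring, weak version. -/
lemma skew_rational_form {D : Type*} [DivisionRing D] (d : ℕ) :
    ∀ (V : Type*) [AddCommGroup V] [Module D V] [FiniteDimensional D V]
    (_ : finrank D V = d) (T : V →ₗ[D] V),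
    ∃ (ι : Type) (_ : Fintype ι) (b : ι → V) (a : ι → ι → D) (E : Finset D),
      LinearIndependent D b ∧ Submodule.span D (Set.range b) = ⊤ ∧
      E.card ≤ d ∧ (∀ i j, a i j ∈ E ∨ a i j = 0 ∨ a i j = 1) ∧
      ∀ j, T (b j) = ∑ i, a i j • b i := by
  classical
  induction d using Nat.strong_induction_on with
  | _ d ih =>
  intro V _ _ _ hd T
  rcases subsingleton_or_nontrivial V with hV | hV
  · refine ⟨Empty, inferInstance, Empty.elim, fun i => i.elim, ∅, linearIndependent_empty_type,
      Subsingleton.elim _ _, by simp, fun i => i.elim, fun i => i.elim⟩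
  -- maximal cyclic dimension
  let P : ℕ → Prop := fun n => ∃ v : V, LinearIndependent D (fun i : Fin n => (T ^ (i : ℕ)) v)
  have hPb : ∀ n, P n → n ≤ d := by
    rintro n ⟨v, hv⟩
    have := hv.fintype_card_le_finrank
    simpa [hd] using this
  have hP1 : P 1 := by
    obtain ⟨v, hv⟩ := exists_ne (0 : V)
    exact ⟨v, by simpa [linearIndependent_unique_iff] using hv⟩
  obtain ⟨r, hr, hmax⟩ : ∃ r, P r ∧ ∀ n, P n → n ≤ r := by
    have h1d := hPb 1 hP1
    exact ⟨Nat.findGreatest P d, Nat.findGreatest_spec h1d hP1,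
      fun n hn => Nat.le_findGreatest (hPb n hn) hn⟩
  have hr1 := hmax 1 hP1
  obtain ⟨n, rfl⟩ : ∃ n, r = n + 1 := ⟨r - 1, by omega⟩
  obtain ⟨v, hv⟩ := hr
  -- functional
  obtain ⟨f, hf⟩ : ∃ f : V →ₗ[D] D, ∀ i : Fin (n + 1),
      f ((T ^ (i : ℕ)) v) = if i = Fin.last n then 1 else 0 := by
    obtain ⟨f, hf⟩ := ((Basis.span hv).constr ℕ
      (fun i : Fin (n + 1) => if i = Fin.last n then (1 : D) else 0)).exists_extend
    refine ⟨f, fun i => ?_⟩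
    have h2 := (Basis.span hv).constr_basis ℕ
      (fun i : Fin (n + 1) => if i = Fin.last n then (1 : D) else 0) i
    rw [← hf] at h2
    simpa [Basis.span_apply] using h2
  have hf0 : ∀ i < n, f ((T ^ i) v) = 0 := by
    intro i hi
    have := hf ⟨i, by omega⟩
    rw [if_neg (by simp [Fin.ext_iff]; omega)] at this
    exact this
  have hf1 : f ((T ^ n) v) ≠ 0 := by
    have := hf (Fin.last n)
    simp at this
    simp [this]
  let Φ : V →ₗ[D] (Fin (n + 1) → D) := LinearMap.pi (fun i => f ∘ₗ (T ^ (i : ℕ)))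
  let W := LinearMap.ker Φ
  have hWmem : ∀ x, x ∈ W ↔ ∀ i < n + 1, f ((T ^ i) x) = 0 := by
    intro x
    simp only [W, LinearMap.mem_ker, Φ, funext_iff, LinearMap.pi_apply, LinearMap.comp_apply]
    exact ⟨fun h i hi => h ⟨i, hi⟩, fun h i => h i i.2⟩
  have hWT : ∀ x ∈ W, T x ∈ W := by
    intro x hx
    rw [hWmem] at hx ⊢
    have hlast : f ((T ^ (n + 1)) x) = 0 := by
      by_contra hne
      have : P (n + 2) := by
        refine ⟨x, ?_⟩
        rw [Fintype.linearIndependent_iff]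
        intro c hc
        exact skew_coeff_zero T f x (n + 1) hx hne c (fun i _ => by rw [hc]; simp)
      have := hmax _ this
      omega
    intro i hi
    rw [← Module.End.mul_apply, ← pow_succ]
    rcases Nat.lt_or_ge (i + 1) (n + 1) with h | h
    · exact hx _ h
    · rw [show i + 1 = n + 1 by omega]; exact hlast
  let U := Submodule.span D (Set.range (fun i : Fin (n + 1) => (T ^ (i : ℕ)) v))
  have hUW : Disjoint U W := by
    rw [Submodule.disjoint_def]
    intro x hxU hxW
    obtain ⟨c, rfl⟩ := (Submodule.mem_span_range_iff_exists_fun D).1 hxU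
    have := skew_coeff_zero T f v n hf0 hf1 c ((hWmem _).1 hxW)
    simp [this]
  have hUdim : finrank D U = n + 1 := by
    have := finrank_span_eq_card hv
    simpa using this
  have hWdim : d ≤ (n + 1) + finrank D W := by
    have h1 : finrank D (LinearMap.range Φ) + finrank D W = finrank D V :=
      Φ.finrank_range_add_finrank_ker
    have h2 := (LinearMap.range Φ).finrank_le
    rw [finrank_fin_fun] at h2
    rw [hd] at h1
    omega
  have hsum := Submodule.finrank_sup_add_finrank_inf_eq U W
  rw [hUW.eq_bot, finrank_bot, hUdim] at hsum
  have hle := (U ⊔ W).finrank_le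
  have htop : U ⊔ W = ⊤ := by
    apply Submodule.eq_top_of_finrank_eq
    omega
  -- companion relation
  obtain ⟨c, hc⟩ : ∃ c : Fin (n + 1) → D,
      ∑ i, c i • (T ^ (i : ℕ)) v = (T ^ (n + 1)) v := by
    rw [← Submodule.mem_span_range_iff_exists_fun D]
    by_contra hne
    have : P (n + 2) := by
      refine ⟨v, ?_⟩
      rw [linearIndependent_finSucc']
      refine ⟨?_, ?_⟩
      · exact hv
      · exact hne
    have := hmax _ this
    omega
  obtain ⟨ι, hι, b, a, E, hb, hbs, hE, ha, hT⟩ :=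
    ih (finrank D W) (by omega) W rfl (T.restrict hWT)
  refine ⟨Fin (n + 1) ⊕ ι, inferInstance,
    Sum.elim (fun i : Fin (n + 1) => (T ^ (i : ℕ)) v) (fun i => (b i : V)),
    fun i j => match i, j with
      | Sum.inl i, Sum.inl j => if j = Fin.last n then c i else
          if (i : ℕ) = j + 1 then 1 else 0
      | Sum.inr _, Sum.inl _ => 0
      | Sum.inl _, Sum.inr _ => 0
      | Sum.inr i, Sum.inr j => a i j,
    Finset.univ.image c ∪ E, ?_, ?_, ?_, ?_, ?_⟩
  · refine LinearIndependent.sum_type hv (hb.map' W.subtype W.ker_subtype) ?_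
    refine hUW.mono_right ?_
    rw [Submodule.span_le]
    rintro _ ⟨i, rfl⟩
    exact (b i).2
  · rw [Set.Sum.elim_range, Submodule.span_union]
    have : Submodule.span D (Set.range (fun i => (b i : V))) = W := by
      have h3 := congrArg (Submodule.map W.subtype) hbs
      rw [Submodule.map_span, ← Set.range_comp, Submodule.map_subtype_top] at h3
      exact h3
    rw [this]
    exact htop
  · refine (Finset.card_union_le _ _).trans ?_
    have : (Finset.univ.image c).card ≤ n + 1 := by
      simpa using (Finset.card_image_le (s := Finset.univ) (f := c))
    omega
  · rintro (i | i) (j | j)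
    · dsimp only
      split_ifs
      · left; simp
      · simp
      · simp
    · simp
    · simp
    · dsimp only
      rcases ha i j with h | h
      · left; simp [h]
      · right; exact h
  · rintro (j | j)
    · simp only [Sum.elim_inl, Fintype.sum_sum_type, Sum.elim_inr, zero_smul,
        Finset.sum_const_zero, add_zero]
      rw [← Module.End.mul_apply, ← pow_succ']
      by_cases hj : j = Fin.last n
      · subst hj
        simp [hc]
      · have hjn : (j : ℕ) < n := by
          have := j.2
          have : (j : ℕ) ≠ n := fun h => hj (Fin.ext h)
          omega
        simp only [if_neg hj]
        rw [Finset.sum_eq_single (⟨j + 1, by omega⟩ : Fin (n + 1))]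
        · simp
        · intro i _ hi
          rw [if_neg, zero_smul]
          intro h
          exact hi (Fin.ext h)
        · simp
    · simp only [Sum.elim_inl, Fintype.sum_sum_type, Sum.elim_inr, zero_smul,
        Finset.sum_const_zero, zero_add]
      have := congrArg (Subtype.val) (hT j)
      simpa using this

/-- `M` as right vector space over a skew subfield. -/
abbrev skewOpModule {M : Type*} [DivisionRing M] (K : Subfield M) : Module (K)ᵐᵒᵖ M :=
  Module.compHom M (RingHom.op K.subtype)

/-- left multiplication as right-linear map -/
def skewMulLeft {M : Type*} [DivisionRing M] (K : Subfield M) (x : M) :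
    letI := skewOpModule K
    M →ₗ[(K)ᵐᵒᵖ] M :=
  letI := skewOpModule K
  { toFun := fun y => x * y
    map_add' := mul_add x
    map_smul' := fun c y => (mul_assoc x y (c.unop : M)).symm }

lemma skew_smul_def {M : Type*} [DivisionRing M] (K : Subfield M) (c : (K)ᵐᵒᵖ) (y : M) :
    letI := skewOpModule K
    c • y = y * (c.unop : M) := rfl

/-- Basis version with plain elements. -/
lemma skew_good_basis {M : Type*} [DivisionRing M] (L : Subfield M) (d : ℕ) (w : Fin d → M)
    (hspan : ∀ x : M, ∃ c : Fin d → M, (∀ i, c i ∈ L) ∧ x = ∑ i, w i * c i)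
    (hind : ∀ c : Fin d → M, (∀ i, c i ∈ L) → ∑ i, w i * c i = 0 → ∀ i, c i = 0) (x : M) :
    ∃ (ι : Type) (_ : Fintype ι) (b : ι → M) (a : ι → ι → M) (E : Finset M),
      Fintype.card ι = d ∧ (E : Set M) ⊆ L ∧ E.card ≤ d ∧
      (∀ y : M, ∃ c : ι → M, (∀ i, c i ∈ L) ∧ y = ∑ i, b i * c i) ∧
      (∀ c : ι → M, (∀ i, c i ∈ L) → ∑ i, b i * c i = 0 → ∀ i, c i = 0) ∧
      (∀ i j, a i j ∈ E ∨ a i j = 0 ∨ a i j = 1) ∧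
      ∀ j, x * b j = ∑ i, b i * a i j := by
  classical
  letI := skewOpModule L
  have hli : LinearIndependent (L)ᵐᵒᵖ w := by
    rw [Fintype.linearIndependent_iff]
    intro g hg i
    have := hind (fun i => ((g i).unop : M)) (fun i => (g i).unop.2) hg i
    exact MulOpposite.unop_injective (Subtype.ext this)
  have hsp : ⊤ ≤ Submodule.span (L)ᵐᵒᵖ (Set.range w) := by
    intro y _
    obtain ⟨c, hc, rfl⟩ := hspan y
    rw [Submodule.mem_span_range_iff_exists_fun]
    exact ⟨fun i => MulOpposite.op ⟨c i, hc i⟩, rfl⟩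
  let B := Module.Basis.mk hli hsp
  haveI : FiniteDimensional (L)ᵐᵒᵖ M := Module.Basis.finiteDimensional_of_finite B
  have hd : Module.finrank (L)ᵐᵒᵖ M = d := by
    simpa using Module.finrank_eq_card_basis B
  obtain ⟨ι, hι, b, a, E, hb, hbs, hE, ha, hT⟩ := skew_rational_form d M hd (skewMulLeft L x)
  refine ⟨ι, hι, b, fun i j => ((a i j).unop : M), E.image (fun e => (e.unop : M)), ?_, ?_, ?_,
    ?_, ?_, ?_, ?_⟩
  · rw [← hd]
    exact (Module.finrank_eq_card_basis (Module.Basis.mk hb hbs.ge)).symm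
  · intro y hy
    simp only [Finset.coe_image, Set.mem_image] at hy
    obtain ⟨e, _, rfl⟩ := hy
    exact e.unop.2
  · exact Finset.card_image_le.trans hE
  · intro y
    have hy : y ∈ Submodule.span (L)ᵐᵒᵖ (Set.range b) := by rw [hbs]; trivial
    obtain ⟨c, hc⟩ := (Submodule.mem_span_range_iff_exists_fun _).1 hy
    exact ⟨fun i => ((c i).unop : M), fun i => (c i).unop.2, hc.symm⟩
  · intro c hc h i
    have := Fintype.linearIndependent_iff.1 hb (fun i => MulOpposite.op ⟨c i, hc i⟩) h i
    exact congrArg (fun e : (L)ᵐᵒᵖ => (e.unop : M)) this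
  · intro i j
    rcases ha i j with h | h | h
    · left; exact Finset.mem_image_of_mem _ h
    · right; left; simp [h]
    · right; right; simp [h]
  · exact hT

/-- If the generators preserve the `K`-span of `b`, so does everything in `M`. -/
lemma skew_stable {M : Type*} [DivisionRing M] (K : Subfield M) (G : Set M)
    (hG : Subfield.closure G = ⊤) {ι : Type} [Fintype ι] (b : ι → M)
    (h : ∀ g ∈ G, ∀ j, ∃ c : ι → M, (∀ i, c i ∈ K) ∧ g * b j = ∑ i, b i * c i) :
    ∀ (x : M) (j : ι), ∃ c : ι → M, (∀ i, c i ∈ K) ∧ x * b j = ∑ i, b i * c i := by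
  classical
  letI := skewOpModule K
  let W := Submodule.span (K)ᵐᵒᵖ (Set.range b)
  have hW : ∀ y, y ∈ W ↔ ∃ c : ι → M, (∀ i, c i ∈ K) ∧ y = ∑ i, b i * c i := by
    intro y
    rw [Submodule.mem_span_range_iff_exists_fun]
    constructor
    · rintro ⟨c, hc⟩
      exact ⟨fun i => ((c i).unop : M), fun i => (c i).unop.2, hc.symm⟩
    · rintro ⟨c, hc, rfl⟩
      exact ⟨fun i => MulOpposite.op ⟨c i, hc i⟩, rfl⟩
  haveI : FiniteDimensional (K)ᵐᵒᵖ W := FiniteDimensional.span_of_finite _ (Set.finite_range b)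
  have main : ∀ x : M, ∀ y ∈ W, x * y ∈ W := by
    intro x
    have hx : x ∈ Subfield.closure G := by rw [hG]; trivial
    induction hx using Subfield.closure_induction with
    | mem g hg =>
      have : W ≤ W.comap (skewMulLeft K g) := by
        rw [Submodule.span_le]
        rintro _ ⟨j, rfl⟩
        exact (hW _).2 (h g hg j)
      exact fun y hy => this hy
    | one => intro y hy; simpa using hy
    | add x y _ _ hx hy => intro z hz; rw [add_mul]; exact W.add_mem (hx z hz) (hy z hz)
    | neg x _ hx => intro z hz; rw [neg_mul]; exact W.neg_mem (hx z hz)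
    | mul x y _ _ hx hy => intro z hz; rw [mul_assoc]; exact hx _ (hy z hz)
    | inv x _ hx =>
      intro z hz
      by_cases hx0 : x = 0
      · simp [hx0]
      have hinj : Function.Injective ((skewMulLeft K x).restrict hx : W →ₗ[(K)ᵐᵒᵖ] W) := by
        intro p q hpq
        have h2 : x * (p : M) = x * q := congrArg Subtype.val hpq
        exact Subtype.ext (mul_left_cancel₀ hx0 h2)
      obtain ⟨p, hp⟩ := (LinearMap.injective_iff_surjective.1 hinj) ⟨z, hz⟩
      have h2 : x * (p : M) = z := congrArg Subtype.val hp
      rw [← h2, inv_mul_cancel_left₀ hx0]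
      exact p.2
  intro x j
  exact (hW _).1 (main x _ (Submodule.subset_span ⟨j, rfl⟩))

/-- **Theorem (finite generation of skew subfields).**
Let `L ⊆ M` be skew fields over `k`. If `M` is generated as a skew field over `k`
by `m ≥ 1` elements, and `M` has a right `L`-basis of size `d` (i.e. `dim M_L = d`
is finite), then `L` is generated as a skew field over `k` by at most
`d²(m−1)+d` elements. -/
theorem finite_generation_of_skew_subfield
    (k M : Type*) [Field k] [DivisionRing M] [Algebra k M]
    (L : Subfield M) (hkL : Set.range (algebraMap k M) ⊆ (L : Set M))
    (m : ℕ) (hm : 1 ≤ m) (S : Finset M) (hScard : S.card ≤ m)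
    (hSgen : Subfield.closure (Set.range (algebraMap k M) ∪ (S : Set M)) = ⊤)
    (d : ℕ) (w : Fin d → M)
    -- `w` is a basis of `M` as a right `L`-vector space:
    (hspan : ∀ x : M, ∃ c : Fin d → M, (∀ i, c i ∈ L) ∧ x = ∑ i, w i * c i)
    (hind : ∀ c : Fin d → M, (∀ i, c i ∈ L) → ∑ i, w i * c i = 0 → ∀ i, c i = 0) :
    ∃ T : Finset M, (T : Set M) ⊆ (L : Set M) ∧ T.card ≤ d ^ 2 * (m - 1) + d ∧
      Subfield.closure (Set.range (algebraMap k M) ∪ (T : Set M)) = L := by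

  classical
  obtain ⟨x, hxS⟩ : ∃ x : M, (S.erase x).card ≤ m - 1 := by
    rcases S.eq_empty_or_nonempty with rfl | ⟨x, hx⟩
    · exact ⟨0, by simp⟩
    · exact ⟨x, by rw [Finset.card_erase_of_mem hx]; omega⟩
  obtain ⟨ι, hι, b, a, E, hcard, hEL, hEc, hbs, hbi, ha, hxb⟩ := skew_good_basis L d w hspan hind x
  choose A hAL hA using fun (s : M) (j : ι) => hbs (s * b j)
  let F : Finset M := ((S.erase x) ×ˢ (Finset.univ : Finset (ι × ι))).image
    (fun p => A p.1 p.2.1 p.2.2)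
  let T := F ∪ E
  have hTL : (T : Set M) ⊆ L := by
    intro y hy
    rcases Finset.mem_union.1 (Finset.mem_coe.1 hy) with h | h
    · obtain ⟨p, _, rfl⟩ := Finset.mem_image.1 h
      exact hAL _ _ _
    · exact hEL h
  have hKL : Subfield.closure (Set.range (algebraMap k M) ∪ (T : Set M)) ≤ L :=
    Subfield.closure_le.2 (Set.union_subset hkL hTL)
  refine ⟨T, hTL, ?_, le_antisymm hKL ?_⟩
  · refine (Finset.card_union_le _ _).trans (Nat.add_le_add ?_ hEc)
    refine Finset.card_image_le.trans ?_
    rw [Finset.card_product, Finset.card_univ, Fintype.card_prod, hcard, ← pow_two, mul_comm]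
    exact Nat.mul_le_mul_left _ hxS
  · intro l hl
    have hTK : ∀ t ∈ T, t ∈ Subfield.closure (Set.range (algebraMap k M) ∪ (T : Set M)) :=
      fun t ht => Subfield.subset_closure (Or.inr ht)
    generalize hK : Subfield.closure (Set.range (algebraMap k M) ∪ (T : Set M)) = K at *
    have hst := skew_stable K _ hSgen b (by
      rintro g (⟨c, rfl⟩ | hg) j
      · refine ⟨Pi.single j (algebraMap k M c), fun i => ?_, ?_⟩
        · by_cases hij : i = j
          · subst hij
            rw [Pi.single_eq_same, ← hK]
            exact Subfield.subset_closure (Or.inl ⟨c, rfl⟩)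
          · rw [Pi.single_eq_of_ne hij]; exact K.zero_mem
        · rw [Finset.sum_eq_single j]
          · rw [Pi.single_eq_same, Algebra.commutes]
          · intro i _ hij
            rw [Pi.single_eq_of_ne hij, mul_zero]
          · simp
      · by_cases hgx : g = x
        · subst hgx
          refine ⟨fun i => a i j, fun i => ?_, hxb j⟩
          rcases ha i j with h | h | h
          · exact hTK _ (Finset.mem_union_right _ h)
          · show a i j ∈ K; rw [h]; exact K.zero_mem
          · show a i j ∈ K; rw [h]; exact K.one_mem
        · refine ⟨A g j, fun i => hTK _ (Finset.mem_union_left _ ?_), hA g j⟩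
          exact Finset.mem_image.2 ⟨(g, j, i), by simpa [hgx] using hg, rfl⟩)
    have hne : Nonempty ι := by
      by_contra hemp
      rw [not_nonempty_iff] at hemp
      obtain ⟨c, _, h1⟩ := hbs 1
      simp at h1
    obtain ⟨j⟩ := hne
    have hbj : b j ≠ 0 := by
      intro h0
      have := hbi (Pi.single j 1) (fun i => by
        by_cases hij : i = j
        · subst hij; rw [Pi.single_eq_same]; exact L.one_mem
        · rw [Pi.single_eq_of_ne hij]; exact L.zero_mem) (by
        rw [Finset.sum_eq_single j]
        · rw [h0, zero_mul]
        · intro i _ hij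
          rw [Pi.single_eq_of_ne hij, mul_zero]
        · simp) j
      simp at this
    obtain ⟨c, hcK, hc⟩ := hst (b j * l * (b j)⁻¹) j
    rw [inv_mul_cancel_right₀ hbj] at hc
    have h0 := hbi (fun i => c i - (Pi.single j l : ι → M) i) (fun i => by
        refine L.sub_mem (hKL (hcK i)) ?_
        by_cases hij : i = j
        · subst hij; rw [Pi.single_eq_same]; exact hl
        · rw [Pi.single_eq_of_ne hij]; exact L.zero_mem) (by
        simp only [mul_sub, Finset.sum_sub_distrib]
        rw [← hc, sub_eq_zero, Finset.sum_eq_single j]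
        · rw [Pi.single_eq_same]
        · intro i _ hij
          rw [Pi.single_eq_of_ne hij, mul_zero]
        · simp) j
    rw [Pi.single_eq_same, sub_eq_zero] at h0
    rw [← h0]
    exact hcK j
end

section
/- Let L ⊆ M be skew fields over k. Assume that M is generated as a skew field over k by m ≥ 1 elements, and that d := dim _L M, the dimension of M as a left L-vector space, is finite. Then L is generated as a skew field over k by at most d²(m−1)+d elements. -/
open Module in
/-- `T` has a matrix with at most `dim V` entries besides `0` and `1`. -/
def SparseForm (L : Type*) {V : Type*} [DivisionRing L] [AddCommGroup V] [Module L V]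
    (T : V →ₗ[L] V) : Prop :=
  ∃ (ι : Type) (_ : Fintype ι) (b : Basis ι L V) (C : Finset L), C.card ≤ Fintype.card ι ∧
    ∀ i j, b.repr (T (b i)) j ∈ C ∨ b.repr (T (b i)) j = 0 ∨ b.repr (T (b i)) j = 1

open Module in
theorem SparseForm.of_isCompl {L V : Type*} [DivisionRing L] [AddCommGroup V] [Module L V]
    (T : V →ₗ[L] V) (W W' : Submodule L V) (h : IsCompl W W')
    (hW : ∀ x ∈ W, T x ∈ W) (hW' : ∀ x ∈ W', T x ∈ W')
    (g : SparseForm L (T.restrict hW)) (g' : SparseForm L (T.restrict hW')) :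
    SparseForm L T := by
  classical
  obtain ⟨ι, _, b, C, hC, hb⟩ := g
  obtain ⟨ι', _, b', C', hC', hb'⟩ := g'
  refine ⟨ι ⊕ ι', inferInstance, (b.prod b').map (W.prodEquivOfIsCompl W' h), C ∪ C', ?_, ?_⟩
  · rw [Fintype.card_sum]
    exact (Finset.card_union_le _ _).trans (by omega)
  · rintro (i | i) j
    · have e : T (((b.prod b').map (W.prodEquivOfIsCompl W' h)) (Sum.inl i))
          = ((T.restrict hW (b i) : W) : V) := by simp
      rw [e, Basis.map_repr, LinearEquiv.trans_apply,
        Submodule.prodEquivOfIsCompl_symm_apply_left]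
      rcases j with j | j
      · rw [Basis.prod_repr_inl]
        rcases hb i j with h | h
        · exact Or.inl (Finset.mem_union_left _ h)
        · exact Or.inr h
      · rw [Basis.prod_repr_inr]
        simp
    · have e : T (((b.prod b').map (W.prodEquivOfIsCompl W' h)) (Sum.inr i))
          = ((T.restrict hW' (b' i) : W') : V) := by simp
      rw [e, Basis.map_repr, LinearEquiv.trans_apply,
        Submodule.prodEquivOfIsCompl_symm_apply_right]
      rcases j with j | j
      · rw [Basis.prod_repr_inl]
        simp
      · rw [Basis.prod_repr_inr]
        rcases hb' i j with h | h
        · exact Or.inl (Finset.mem_union_right _ h)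
        · exact Or.inr h

theorem triangular_aux {L V : Type*} [DivisionRing L] [AddCommGroup V] [Module L V]
    (T : V →ₗ[L] V) (n : ℕ) (v : V) (φ : V →ₗ[L] L)
    (h0 : ∀ i < n, φ ((T ^ i) v) = 0) (h1 : φ ((T ^ n) v) ≠ 0) (c : Fin (n + 1) → L)
    (hc : ∀ j ≤ n, φ ((T ^ j) (∑ i, c i • (T ^ (i : ℕ)) v)) = 0) : ∀ i, c i = 0 := by
  have key : ∀ k, ∀ i : Fin (n + 1), (i : ℕ) + k = n → c i = 0 := by
    intro k
    induction k using Nat.strong_induction_on with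
    | _ k ih =>
      intro i hi
      have h := hc k (by omega)
      rw [map_sum, map_sum, Finset.sum_eq_single i] at h
      · rw [map_smul, map_smul, ← Module.End.mul_apply, ← pow_add, smul_eq_mul,
          show k + (i : ℕ) = n by omega] at h
        exact (mul_eq_zero.mp h).resolve_right h1
      · intro l _ hl
        have hl' : (l : ℕ) ≠ i := fun h => hl (Fin.ext h)
        rw [map_smul, map_smul, ← Module.End.mul_apply, ← pow_add, smul_eq_mul]
        rcases lt_or_gt_of_ne hl' with h | h
        · rw [h0 _ (by omega), mul_zero]
        · rw [ih (n - l) (by have := l.2; omega) l (by have := l.2; omega), zero_mul]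
      · simp
  intro i
  exact key (n - i) i (by have := i.2; omega)

theorem triangular_li {L V : Type*} [DivisionRing L] [AddCommGroup V] [Module L V]
    (T : V →ₗ[L] V) (n : ℕ) (v : V) (φ : V →ₗ[L] L)
    (h0 : ∀ i < n, φ ((T ^ i) v) = 0) (h1 : φ ((T ^ n) v) ≠ 0) :
    LinearIndependent L (fun i : Fin (n + 1) => (T ^ (i : ℕ)) v) := by
  rw [Fintype.linearIndependent_iff]
  intro c hc
  exact triangular_aux T n v φ h0 h1 c (fun j _ => by rw [hc]; simp)

open Module in
theorem cyclic_sparse {L V : Type*} [DivisionRing L] [AddCommGroup V] [Module L V]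
    (T : V →ₗ[L] V) (n : ℕ) (v : V)
    (hli : LinearIndependent L (fun i : Fin (n + 1) => (T ^ (i : ℕ)) v))
    (hW : ∀ x ∈ Submodule.span L (Set.range (fun i : Fin (n + 1) => (T ^ (i : ℕ)) v)),
      T x ∈ Submodule.span L (Set.range (fun i : Fin (n + 1) => (T ^ (i : ℕ)) v))) :
    SparseForm L (T.restrict hW) := by
  classical
  refine ⟨Fin (n + 1), inferInstance, Basis.span hli,
    Finset.univ.image (fun j => (Basis.span hli).repr
      (T.restrict hW (Basis.span hli (Fin.last n))) j), ?_, ?_⟩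
  · exact Finset.card_image_le.trans (by simp)
  · intro i j
    rcases Fin.eq_castSucc_or_eq_last i with ⟨i, rfl⟩ | rfl
    · right
      have e : T.restrict hW (Basis.span hli i.castSucc) = Basis.span hli i.succ := by
        apply Subtype.ext
        rw [LinearMap.restrict_coe_apply, Basis.span_apply, Basis.span_apply]
        simp [pow_succ', Module.End.mul_apply]
      rw [e, Basis.repr_self, Finsupp.single_apply]
      split_ifs <;> simp
    · left
      exact Finset.mem_image_of_mem _ (Finset.mem_univ _)

open Module in
theorem sparseForm_all {L : Type*} [DivisionRing L] (d : ℕ) :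
    ∀ {V : Type*} [AddCommGroup V] [Module L V] [FiniteDimensional L V]
    (_ : finrank L V = d) (T : V →ₗ[L] V), SparseForm L T := by
  classical
  induction d using Nat.strong_induction_on with
  | _ d ih =>
  intro V _ _ _ hd T
  by_cases hV : Subsingleton V
  · exact ⟨Fin 0, inferInstance, Basis.empty V, ∅, by simp, fun i => i.elim0⟩
  rw [not_subsingleton_iff_nontrivial] at hV
  let P : ℕ → Prop := fun n => ∃ (v : V) (φ : V →ₗ[L] L),
    (∀ i < n, φ ((T ^ i) v) = 0) ∧ φ ((T ^ n) v) ≠ 0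
  have hPb : ∀ n, P n → n ≤ d := by
    rintro n ⟨v, φ, h0, h1⟩
    have := (triangular_li T n v φ h0 h1).fintype_card_le_finrank
    simp at this
    omega
  have hP0 : P 0 := by
    obtain ⟨v, hv⟩ := exists_ne (0 : V)
    obtain ⟨φ, hφ, -⟩ := Submodule.exists_le_ker_of_notMem (K := L) (p := ⊥) (v := v) (by simpa)
    exact ⟨v, φ, by simp, by simpa⟩
  let n := Nat.findGreatest P d
  obtain ⟨v, φ, h0, h1⟩ : P n := Nat.findGreatest_spec (Nat.zero_le d) hP0
  have hmax : ¬ P (n + 1) := by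
    intro h
    have : n + 1 ≤ n := Nat.le_findGreatest (hPb _ h) h
    omega
  have hli := triangular_li T n v φ h0 h1
  set W := Submodule.span L (Set.range (fun i : Fin (n + 1) => (T ^ (i : ℕ)) v)) with hWdef
  have hmem : ∀ i ≤ n, (T ^ i) v ∈ W := fun i hi =>
    Submodule.subset_span ⟨⟨i, by omega⟩, rfl⟩
  have hmem' : (T ^ (n + 1)) v ∈ W := by
    by_contra hcon
    obtain ⟨ψ, hψ, hk⟩ := Submodule.exists_le_ker_of_notMem hcon
    exact hmax ⟨v, ψ, fun i hi => hk (hmem i (by omega)), hψ⟩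
  have hW : ∀ x ∈ W, T x ∈ W := by
    intro x hx
    have : W ≤ W.comap T := by
      rw [hWdef, Submodule.span_le, ← hWdef]
      rintro _ ⟨i, rfl⟩
      change T ((T ^ (i : ℕ)) v) ∈ W
      rw [← Module.End.mul_apply, ← pow_succ']
      rcases Nat.lt_or_ge i n with h | h
      · exact hmem _ h
      · have : (i : ℕ) = n := by have := i.2; omega
        rw [this]
        exact hmem'
    exact this hx
  let Φ : V →ₗ[L] (Fin (n + 1) → L) := LinearMap.pi (fun i => φ ∘ₗ (T ^ (i : ℕ)))
  have hΦ : ∀ x, x ∈ LinearMap.ker Φ ↔ ∀ j ≤ n, φ ((T ^ j) x) = 0 := by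
    intro x
    rw [LinearMap.mem_ker, funext_iff]
    constructor
    · intro h j hj
      exact h ⟨j, by omega⟩
    · intro h j
      exact h j (by have := j.2; omega)
  have hW' : ∀ x ∈ LinearMap.ker Φ, T x ∈ LinearMap.ker Φ := by
    intro x hx
    rw [hΦ] at hx ⊢
    intro j hj
    rw [← Module.End.mul_apply, ← pow_succ]
    rcases Nat.lt_or_ge j n with h | h
    · exact hx _ h
    · have : j = n := by omega
      rw [this]
      by_contra hcon
      exact hmax ⟨x, φ, fun i hi => hx i (by omega), hcon⟩
  have hdis : Disjoint W (LinearMap.ker Φ) := by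
    rw [Submodule.disjoint_def]
    intro x hx hx'
    obtain ⟨c, rfl⟩ := (Submodule.mem_span_range_iff_exists_fun L).mp hx
    have := triangular_aux T n v φ h0 h1 c ((hΦ _).mp hx')
    simp [this]
  have hWfin : finrank L W = n + 1 := by
    rw [hWdef, finrank_span_eq_card hli, Fintype.card_fin]
  have hrk := LinearMap.finrank_range_add_finrank_ker Φ
  have hrange : finrank L (LinearMap.range Φ) ≤ n + 1 := by
    have := Submodule.finrank_le (LinearMap.range Φ)
    simpa using this
  have hcompl : IsCompl W (LinearMap.ker Φ) :=
    (Submodule.isCompl_iff_disjoint _ _ (by omega)).mpr hdis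
  have hsum := Submodule.finrank_add_eq_of_isCompl hcompl
  exact SparseForm.of_isCompl T W _ hcompl hW hW' (cyclic_sparse T n v hli hW)
    (ih _ (by omega) rfl _)



/-- **Theorem (finite generation of skew subfields, left version).**
Let `L ⊆ M` be skew fields over `k`. If `M` is generated as a skew field over `k`
by `m ≥ 1` elements, and `M` has a left `L`-basis of size `d` (i.e. `dim _L M = d`
is finite), then `L` is generated as a skew field over `k` by at most
`d²(m−1)+d` elements. -/
theorem finite_generation_of_skew_subfield_left
    (k M : Type*) [Field k] [DivisionRing M] [Algebra k M]
    (L : Subfield M) (hkL : Set.range (algebraMap k M) ⊆ (L : Set M))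
    (m : ℕ) (hm : 1 ≤ m) (S : Finset M) (hScard : S.card ≤ m)
    (hSgen : Subfield.closure (Set.range (algebraMap k M) ∪ (S : Set M)) = ⊤)
    (d : ℕ) (w : Fin d → M)
    -- `w` is a basis of `M` as a left `L`-vector space:
    (hspan : ∀ x : M, ∃ c : Fin d → M, (∀ i, c i ∈ L) ∧ x = ∑ i, c i * w i)
    (hind : ∀ c : Fin d → M, (∀ i, c i ∈ L) → ∑ i, c i * w i = 0 → ∀ i, c i = 0) :
    ∃ T : Finset M, (T : Set M) ⊆ (L : Set M) ∧ T.card ≤ d ^ 2 * (m - 1) + d ∧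
      Subfield.closure (Set.range (algebraMap k M) ∪ (T : Set M)) = L := by
  classical
  have hLspan : ∀ x : M, x ∈ Submodule.span L (Set.range w) := by
    intro x
    obtain ⟨c, hc, rfl⟩ := hspan x
    refine Submodule.sum_mem _ fun i _ => ?_
    exact Submodule.smul_mem _ (⟨c i, hc i⟩ : L) (Submodule.subset_span ⟨i, rfl⟩)
  have hLli : LinearIndependent L w := by
    rw [Fintype.linearIndependent_iff]
    intro c hc i
    exact Subtype.ext (hind (fun i => (c i : M)) (fun i => (c i).2) hc i)
  let B : Module.Basis (Fin d) L M := Module.Basis.mk hLli (fun x _ => hLspan x)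
  haveI : FiniteDimensional L M := Module.Finite.of_basis B
  -- split off one generator
  obtain ⟨x, S', hS', hSS⟩ : ∃ (x : M) (S' : Finset M), S'.card ≤ m - 1 ∧ S ⊆ insert x S' := by
    rcases S.eq_empty_or_nonempty with rfl | ⟨x, hx⟩
    · exact ⟨0, ∅, by simp, by simp⟩
    · refine ⟨x, S.erase x, ?_, ?_⟩
      · rw [Finset.card_erase_of_mem hx]; omega
      · rw [Finset.insert_erase hx]
  obtain ⟨ι, _, b, C, hC, hb⟩ := sparseForm_all (Module.finrank L M) rfl (LinearMap.mulRight L x)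
  have hcard : Fintype.card ι = d := by
    rw [← Module.finrank_eq_card_basis b, Module.finrank_eq_card_basis B, Fintype.card_fin]
  rw [hcard] at hC
  let C' : Finset L := C ∪ (S' ×ˢ (Finset.univ : Finset (ι × ι))).image
    (fun p => b.repr (b p.2.1 * p.1) p.2.2)
  have hC' : C'.card ≤ d ^ 2 * (m - 1) + d := by
    refine (Finset.card_union_le _ _).trans ?_
    rw [add_comm]
    refine add_le_add (Finset.card_image_le.trans ?_) hC
    rw [Finset.card_product, Finset.card_univ, Fintype.card_prod, hcard, mul_comm, ← sq]
    exact Nat.mul_le_mul_left _ hS'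
  let T : Finset M := C'.image (fun c : L => (c : M))
  have hTL : (T : Set M) ⊆ (L : Set M) := by
    intro y hy
    obtain ⟨c, -, rfl⟩ := Finset.mem_image.mp hy
    exact c.2
  refine ⟨T, hTL, Finset.card_image_le.trans hC', ?_⟩
  set L' := Subfield.closure (Set.range (algebraMap k M) ∪ (T : Set M)) with hL'
  have hC'L' : ∀ c ∈ C', (c : M) ∈ L' := fun c hc =>
    Subfield.subset_closure (Or.inr (Finset.mem_image_of_mem _ hc))
  have hkL' : ∀ a : k, algebraMap k M a ∈ L' := fun a =>
    Subfield.subset_closure (Or.inl ⟨a, rfl⟩)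
  have hle : L' ≤ L := Subfield.closure_le.mpr (Set.union_subset hkL hTL)
  refine le_antisymm hle ?_
  -- the left `L'`-span of the basis `b`
  let V : Submodule L' M :=
    { carrier := {y | ∀ j, ((b.repr y j : L) : M) ∈ L'}
      add_mem' := by
        intro y z hy hz j
        rw [map_add, Finsupp.add_apply]
        exact L'.add_mem (hy j) (hz j)
      zero_mem' := by
        intro j
        rw [map_zero]
        exact L'.zero_mem
      smul_mem' := by
        intro c y hy j
        have e : c • y = (⟨c, hle c.2⟩ : L) • y := rfl
        rw [e, map_smul, Finsupp.smul_apply]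
        exact L'.mul_mem c.2 (hy j) }
  have hVmem : ∀ y, y ∈ V ↔ ∀ j, ((b.repr y j : L) : M) ∈ L' := fun y => Iff.rfl
  have hbV : ∀ i, b i ∈ V := by
    intro i j
    rw [b.repr_self, Finsupp.single_apply]
    split_ifs
    · exact L'.one_mem
    · exact L'.zero_mem
  have hVspan : V ≤ Submodule.span L' (Set.range b) := by
    intro y hy
    rw [← b.sum_repr y]
    refine Submodule.sum_mem _ fun i _ => ?_
    exact Submodule.smul_mem _ (⟨_, hy i⟩ : L') (Submodule.subset_span ⟨i, rfl⟩)
  have hVeq : V = Submodule.span L' (Set.range b) :=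
    le_antisymm hVspan (Submodule.span_le.mpr (by rintro _ ⟨i, rfl⟩; exact hbV i))
  haveI : FiniteDimensional L' V := by
    rw [hVeq]
    exact FiniteDimensional.span_of_finite L' (Set.finite_range b)
  have hstep : ∀ z, (∀ i, b i * z ∈ V) → ∀ y ∈ V, y * z ∈ V := by
    intro z hz y hy
    rw [← b.sum_repr y, Finset.sum_mul]
    refine Submodule.sum_mem _ fun i _ => ?_
    have e : (b.repr y i • b i) * z = (⟨_, hy i⟩ : L') • (b i * z) := mul_assoc _ _ _
    rw [e]
    exact Submodule.smul_mem _ _ (hz i)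
  have hall : ∀ z : M, ∀ y ∈ V, y * z ∈ V := by
    intro z
    have hz : z ∈ Subfield.closure (Set.range (algebraMap k M) ∪ (S : Set M)) := by
      rw [hSgen]; trivial
    induction hz using Subfield.closure_induction with
    | mem z hz =>
      rcases hz with ⟨a, rfl⟩ | hz
      · intro y hy
        rw [← Algebra.commutes]
        exact V.smul_mem (⟨_, hkL' a⟩ : L') hy
      · apply hstep
        intro i j
        rcases Finset.mem_insert.mp (hSS hz) with rfl | hz'
        · rcases hb i j with h | h | h
          · exact hC'L' _ (Finset.mem_union_left _ h)
          · rw [LinearMap.mulRight_apply] at h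
            rw [h]; exact L'.zero_mem
          · rw [LinearMap.mulRight_apply] at h
            rw [h]; exact L'.one_mem
        · exact hC'L' _ (Finset.mem_union_right _ (Finset.mem_image.mpr
            ⟨(z, (i, j)), by simp [hz'], rfl⟩))
    | one => intro y hy; rwa [mul_one]
    | add z z' _ _ h h' => intro y hy; rw [mul_add]; exact V.add_mem (h y hy) (h' y hy)
    | neg z _ h => intro y hy; rw [mul_neg]; exact V.neg_mem (h y hy)
    | mul z z' _ _ h h' => intro y hy; rw [← mul_assoc]; exact h' _ (h y hy)
    | inv z _ h =>
      intro y hy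
      by_cases hz0 : z = 0
      · rw [hz0, inv_zero, mul_zero]; exact V.zero_mem
      have hinj : Function.Injective ((LinearMap.mulRight L' z).restrict h) := by
        intro p q hpq
        have := congrArg Subtype.val hpq
        exact Subtype.ext (mul_right_cancel₀ hz0 this)
      obtain ⟨p, hp⟩ := LinearMap.injective_iff_surjective.mp hinj ⟨y, hy⟩
      have hp' : (p : M) * z = y := congrArg Subtype.val hp
      rw [← hp', mul_assoc, mul_inv_cancel₀ hz0, mul_one]
      exact p.2
  intro a ha
  haveI : Nonempty ι := b.index_nonempty
  obtain ⟨i⟩ := ‹Nonempty ι›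
  have h := hall ((b i)⁻¹ * (a * b i)) (b i) (hbV i)
  rw [mul_inv_cancel_left₀ (b.ne_zero i)] at h
  have e : a * b i = (⟨a, ha⟩ : L) • b i := rfl
  have h2 := (hVmem _).mp h i
  rw [e, map_smul, Finsupp.smul_apply, b.repr_self, Finsupp.single_eq_same, smul_eq_mul,
    mul_one] at h2
  exact h2
end

section
/- Let G be a finite group acting faithfully by k-algebra automorphisms on a skew field M, and assume M is generated as a skew field over k by m ≥ 1 elements. Then the invariant skew field M^G is generated as a skew field over k by at most |G|²(m−1)+|G| elements. -/
/-- The invariant skew field. -/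
def invSub {k M : Type*} [Field k] [DivisionRing M] [Algebra k M]
    {G : Type*} [Group G] (φ : G →* (M ≃ₐ[k] M)) : Subfield M where
  carrier := {a : M | ∀ g : G, φ g a = a}
  mul_mem' := fun {a b} ha hb g => by rw [map_mul, ha g, hb g]
  one_mem' := fun g => map_one _
  add_mem' := fun {a b} ha hb g => by rw [map_add, ha g, hb g]
  zero_mem' := fun g => map_zero _
  neg_mem' := fun {a} ha g => by rw [map_neg, ha g]
  inv_mem' := fun a ha g => by rw [map_inv₀, ha g]

theorem mem_invSub {k M : Type*} [Field k] [DivisionRing M] [Algebra k M]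
    {G : Type*} [Group G] (φ : G →* (M ≃ₐ[k] M)) (a : M) :
    a ∈ invSub φ ↔ ∀ g : G, φ g a = a := Iff.rfl

/-- Artin's independence argument. -/
theorem artin_indep {k M : Type*} [Field k] [DivisionRing M] [Algebra k M]
    {G : Type*} [Group G] (φ : G →* (M ≃ₐ[k] M)) (s : Finset M) :
    LinearIndepOn (invSub φ) id (s : Set M) →
    ∀ c : M → M, (∀ g : G, ∑ x ∈ s, c x * φ g x = 0) → ∀ x ∈ s, c x = 0 := by
  classical
  induction s using Finset.induction_on with
  | empty => intro _ c _ x hx; simp at hx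
  | insert a s ha ih =>
    intro hli c hc
    have hs : LinearIndepOn (invSub φ) id (s : Set M) := hli.mono (by simp)
    have IH := ih hs
    by_cases hca : c a = 0
    · have h1 := IH c (fun g => by
        have := hc g
        rwa [Finset.sum_insert ha, hca, zero_mul, zero_add] at this)
      intro x hx
      rcases Finset.mem_insert.1 hx with rfl | hx
      · exact hca
      · exact h1 x hx
    · exfalso
      set d : M → M := fun x => (c a)⁻¹ * c x with hd
      have hda : d a = 1 := inv_mul_cancel₀ hca
      have hdsum : ∀ g : G, ∑ x ∈ insert a s, d x * φ g x = 0 := fun g => by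
        have := hc g
        simp only [hd, mul_assoc, ← Finset.mul_sum, this, mul_zero]
      have hinv : ∀ h : G, ∀ x ∈ s, φ h (d x) - d x = 0 := by
        intro h
        refine IH (fun x => φ h (d x) - d x) ?_
        intro g
        have h1 : ∑ x ∈ insert a s, φ h (d x) * φ g x = 0 := by
          have := congrArg (φ h) (hdsum (h⁻¹ * g))
          rw [map_sum, map_zero] at this
          rw [← this]
          refine Finset.sum_congr rfl fun x _ => ?_
          rw [map_mul (φ h) (d x) (φ (h⁻¹ * g) x), ← AlgEquiv.mul_apply (φ h), ← map_mul φ, mul_inv_cancel_left]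
        have h2 := hdsum g
        rw [Finset.sum_insert ha, hda] at h1 h2
        rw [map_one] at h1
        simp only [sub_mul, Finset.sum_sub_distrib]
        have h3 := h1.trans h2.symm
        rw [add_left_cancel h3, sub_self]
      have hmem : ∀ x ∈ insert a s, d x ∈ invSub φ := by
        intro x hx g
        rcases Finset.mem_insert.1 hx with rfl | hx
        · rw [hda, map_one]
        · exact sub_eq_zero.1 (hinv g x hx)
      rw [linearIndepOn_finset_iff] at hli
      have := hli (fun x => if hx : d x ∈ invSub φ then ⟨d x, hx⟩ else 0) (by
        rw [← hdsum 1]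
        refine Finset.sum_congr rfl fun x hx => ?_
        simp [hmem x hx, Subfield.smul_def]) a (Finset.mem_insert_self _ _)
      rw [dif_pos (hmem a (Finset.mem_insert_self _ _))] at this
      have h0 : d a = 0 := congrArg Subtype.val this
      rw [hda] at h0
      exact one_ne_zero h0

theorem artin_card {k M : Type*} [Field k] [DivisionRing M] [Algebra k M]
    {G : Type*} [Group G] [Fintype G] (φ : G →* (M ≃ₐ[k] M)) (s : Finset M)
    (hs : LinearIndepOn (invSub φ) id (s : Set M)) : s.card ≤ Fintype.card G := by
  have h : LinearIndepOn M (fun x : M => fun g : G => φ g x) (s : Set M) := by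
    rw [linearIndepOn_finset_iff]
    intro c hc
    refine artin_indep φ s hs c fun g => ?_
    have := congrFun hc g
    simpa using this
  have h2 := LinearIndependent.fintype_card_le_finrank h
  simpa using h2

theorem stable_eq_top {k M : Type*} [Field k] [DivisionRing M] [Algebra k M]
    (S : Set M)
    (hSgen : Subfield.closure (Set.range (algebraMap k M) ∪ S) = ⊤)
    (F : Subfield M) (hF : ∀ a : k, algebraMap k M a ∈ F) (B : Finset M) (h1 : (1 : M) ∈ B)
    (hB : ∀ b ∈ B, ∀ s ∈ S, b * s ∈ Submodule.span F (B : Set M)) :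
    Submodule.span F (B : Set M) = ⊤ := by
  set W := Submodule.span F (B : Set M) with hW
  have hfin : FiniteDimensional F W := FiniteDimensional.span_finset F B
  have key : ∀ a ∈ Subfield.closure (Set.range (algebraMap k M) ∪ S), ∀ w ∈ W, w * a ∈ W := by
    intro a ha
    induction ha using Subfield.closure_induction with
    | mem x hx =>
      rcases hx with ⟨y, rfl⟩ | hx
      · intro w hw
        rw [← Algebra.commutes]
        exact W.smul_mem ⟨_, hF y⟩ hw
      · intro w hw
        induction hw using Submodule.span_induction with
        | mem b hb => exact hB b hb x hx
        | zero => simp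
        | add u v _ _ hu hv => rw [add_mul]; exact W.add_mem hu hv
        | smul r u _ hu => rw [smul_mul_assoc]; exact W.smul_mem r hu
    | one => simp
    | add x y _ _ hx hy => intro w hw; rw [mul_add]; exact W.add_mem (hx w hw) (hy w hw)
    | neg x _ hx => intro w hw; rw [mul_neg]; exact W.neg_mem (hx w hw)
    | mul x y _ _ hx hy => intro w hw; rw [← mul_assoc]; exact hy _ (hx w hw)
    | inv x _ hx =>
      intro w hw
      by_cases hx0 : x = 0
      · simp [hx0]
      let f : W →ₗ[F] W :=
        { toFun := fun w => ⟨w.1 * x, hx w.1 w.2⟩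
          map_add' := fun u v => Subtype.ext (add_mul _ _ _)
          map_smul' := fun r u => Subtype.ext (smul_mul_assoc r u.1 x) }
      have hinj : Function.Injective f := fun u v huv =>
        Subtype.ext (mul_right_cancel₀ hx0 (congrArg Subtype.val huv))
      obtain ⟨u, hu⟩ := LinearMap.surjective_of_injective hinj ⟨w, hw⟩
      have hu' : u.1 * x = w := congrArg Subtype.val hu
      rw [← hu', mul_inv_cancel_right₀ hx0]
      exact u.2
  rw [eq_top_iff]
  intro a _
  have := key a (by rw [hSgen]; trivial) 1 (Submodule.subset_span h1)
  rwa [one_mul] at this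

/-- Schreier-type basis: a basis with a tree of trivial multiplications. -/
theorem schreier_basis {k M : Type*} [Field k] [DivisionRing M] [Algebra k M]
    {G : Type*} [Group G] [Fintype G] (φ : G →* (M ≃ₐ[k] M)) (S : Finset M)
    (hSgen : Subfield.closure (Set.range (algebraMap k M) ∪ (S : Set M)) = ⊤) :
    ∃ (B : Finset M) (E : Finset (M × M)), (1 : M) ∈ B ∧
      LinearIndepOn (invSub φ) id (B : Set M) ∧ E ⊆ B ×ˢ S ∧ E.card + 1 = B.card ∧
      (∀ p ∈ E, p.1 * p.2 ∈ B) ∧ Submodule.span (invSub φ) (B : Set M) = ⊤ := by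
  classical
  by_contra hcon
  have step : ∀ n : ℕ, ∃ (B : Finset M) (E : Finset (M × M)), (1 : M) ∈ B ∧
      LinearIndepOn (invSub φ) id (B : Set M) ∧ E ⊆ B ×ˢ S ∧ E.card + 1 = B.card ∧
      (∀ p ∈ E, p.1 * p.2 ∈ B) ∧ n ≤ B.card := by
    intro n
    induction n with
    | zero =>
      refine ⟨{1}, ∅, by simp, ?_, by simp, by simp, by simp, by simp⟩
      rw [Finset.coe_singleton]
      exact LinearIndepOn.singleton (by simp)
    | succ n ih =>
      obtain ⟨B, E, h1, hli, hE, hcard, hEB, hn⟩ := ih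
      have hex : ∃ b ∈ B, ∃ s ∈ S, b * s ∉ Submodule.span (invSub φ) (B : Set M) := by
        by_contra hno
        push Not at hno
        exact hcon ⟨B, E, h1, hli, hE, hcard, hEB,
          stable_eq_top (S : Set M) hSgen (invSub φ) (fun a g => (φ g).commutes a) B h1 hno⟩
      obtain ⟨b, hb, s, hs, hbs⟩ := hex
      have hnB : b * s ∉ B := fun h => hbs (Submodule.subset_span h)
      have hnE : (b, s) ∉ E := fun h => hnB (hEB _ h)
      refine ⟨insert (b * s) B, insert (b, s) E, Finset.mem_insert_of_mem h1, ?_, ?_, ?_, ?_, ?_⟩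
      · rw [Finset.coe_insert]
        exact hli.insert (by simpa using hbs)
      · intro p hp
        rw [Finset.mem_product]
        rcases Finset.mem_insert.1 hp with rfl | hp
        · exact ⟨Finset.mem_insert_of_mem hb, hs⟩
        · have := Finset.mem_product.1 (hE hp)
          exact ⟨Finset.mem_insert_of_mem this.1, this.2⟩
      · rw [Finset.card_insert_of_notMem hnB, Finset.card_insert_of_notMem hnE, hcard]
      · intro p hp
        rcases Finset.mem_insert.1 hp with rfl | hp
        · exact Finset.mem_insert_self _ _
        · exact Finset.mem_insert_of_mem (hEB p hp)
      · rw [Finset.card_insert_of_notMem hnB]; omega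
  obtain ⟨B, E, _, hli, _, _, _, hn⟩ := step (Fintype.card G + 1)
  have := artin_card φ B hli
  omega



/-- **Corollary (finite generation of invariants).**
Let `G` be a finite group acting faithfully by `k`-algebra automorphisms on a skew
field `M`, and suppose `M` is generated as a skew field over `k` by `m ≥ 1`
elements. Then the invariant skew field `M^G` is generated as a skew field over
`k` by at most `|G|²(m−1)+|G|` elements. -/
theorem invariants_finitely_generated
    (k M : Type*) [Field k] [DivisionRing M] [Algebra k M]
    (G : Type*) [Group G] [Fintype G]
    (φ : G →* (M ≃ₐ[k] M)) (hφ : Function.Injective φ)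
    (m : ℕ) (hm : 1 ≤ m) (S : Finset M) (hScard : S.card ≤ m)
    (hSgen : Subfield.closure (Set.range (algebraMap k M) ∪ (S : Set M)) = ⊤) :
    ∃ T : Finset M, (∀ x ∈ T, ∀ g : G, φ g x = x) ∧
      T.card ≤ Fintype.card G ^ 2 * (m - 1) + Fintype.card G ∧
      (Subfield.closure (Set.range (algebraMap k M) ∪ (T : Set M)) : Set M)
        = {a : M | ∀ g : G, φ g a = a} := by
  classical
  obtain ⟨B, E, h1, hli, hE, hcard, hEB, hspan⟩ := schreier_basis φ S hSgen
  have hd := artin_card φ B hli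
  have hrep : ∀ x : M, ∃ c : M → invSub φ, ∑ b ∈ B, c b • b = x := by
    intro x
    have hx : x ∈ Submodule.span (invSub φ) (B : Set M) := by rw [hspan]; trivial
    obtain ⟨c, -, hc⟩ := Submodule.mem_span_finset.1 hx
    exact ⟨c, hc⟩
  choose c hc using hrep
  let N := B ×ˢ S \ E
  let T : Finset M := (N ×ˢ B).image fun q => (c (q.1.1 * q.1.2) q.2 : M)
  have hTinv : ∀ x ∈ T, ∀ g : G, φ g x = x := by
    intro x hx
    obtain ⟨q, -, rfl⟩ := Finset.mem_image.1 hx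
    exact (c (q.1.1 * q.1.2) q.2).2
  set L := Subfield.closure (Set.range (algebraMap k M) ∪ (T : Set M)) with hL
  have hLK : L ≤ invSub φ := by
    rw [hL, Subfield.closure_le]
    rintro x (⟨a, rfl⟩ | hx)
    · exact fun g => (φ g).commutes a
    · exact hTinv x hx
  have hTL : ∀ x ∈ T, x ∈ L := fun x hx => Subfield.subset_closure (Or.inr hx)
  have hLtop : Submodule.span L (B : Set M) = ⊤ := by
    refine stable_eq_top (S : Set M) hSgen L
      (fun a => Subfield.subset_closure (Or.inl ⟨a, rfl⟩)) B h1 ?_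
    intro b hb s hs
    by_cases hp : (b, s) ∈ E
    · exact Submodule.subset_span (hEB _ hp)
    · rw [← hc (b * s)]
      refine Submodule.sum_mem _ fun x hx => ?_
      have hmem : (c (b * s) x : M) ∈ L := by
        refine hTL _ (Finset.mem_image.2 ⟨((b, s), x), ?_, rfl⟩)
        exact Finset.mem_product.2 ⟨Finset.mem_sdiff.2 ⟨Finset.mem_product.2 ⟨hb, hs⟩, hp⟩, hx⟩
      exact Submodule.smul_mem _ (⟨_, hmem⟩ : L) (Submodule.subset_span hx)
  refine ⟨T, hTinv, ?_, ?_⟩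
  · have hN : N.card + E.card = B.card * S.card := by
      rw [← Finset.card_product]
      exact Finset.card_sdiff_add_card_eq_card hE
    have hT : T.card ≤ N.card * B.card := by
      rw [← Finset.card_product]
      exact Finset.card_image_le
    obtain ⟨r, rfl⟩ : ∃ r, m = r + 1 := ⟨m - 1, by omega⟩
    rw [Nat.add_sub_cancel]
    have hN2 : N.card ≤ B.card * r + 1 := by
      have : B.card * S.card ≤ B.card * (r + 1) := Nat.mul_le_mul_left _ hScard
      rw [mul_add, mul_one] at this
      omega
    calc T.card ≤ N.card * B.card := hT
      _ ≤ (B.card * r + 1) * B.card := Nat.mul_le_mul_right _ hN2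
      _ = B.card ^ 2 * r + B.card := by ring
      _ ≤ Fintype.card G ^ 2 * r + Fintype.card G := by gcongr
  · apply Set.Subset.antisymm
    · exact fun x hx => hLK hx
    · intro a ha
      have hx : a ∈ Submodule.span L (B : Set M) := by rw [hLtop]; trivial
      obtain ⟨l, -, hl⟩ := Submodule.mem_span_finset.1 hx
      rw [linearIndepOn_finset_iff] at hli
      have h0 := hli (fun x => (⟨l x, hLK (l x).2⟩ : invSub φ) -
        (if x = 1 then (⟨a, ha⟩ : invSub φ) else 0)) (by
          simp only [sub_smul, Finset.sum_sub_distrib, ite_smul, zero_smul, id]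
          rw [Finset.sum_ite_eq' B (1 : M), if_pos h1, sub_eq_zero]
          simpa [Subfield.smul_def] using hl) 1 h1
      rw [if_pos rfl, sub_eq_zero] at h0
      have h2 : (l 1 : M) = a := congrArg Subtype.val h0
      rw [← h2]
      exact (l 1).2
end

section
/- Let L ⊆ M be skew fields over k. Suppose V ⊆ M is a finite-dimensional k-subspace that generates M as a skew field over k, and that d := dim M_L, the dimension of M as a right L-vector space, is finite. Then there exists a k-subspace W of M with the following properties: (1) the right L-submodule of M generated by W equals M, and dim_k W = d (so any k-basis of W is a right L-basis of M); (2) 1 ∈ W and W ⊆ k·1 + V·W, where V·W denotes the k-linear span of the products vw with v ∈ V and w ∈ W. -/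
theorem aux_full {K M k : Type*} [Field k] [DivisionRing M] [Algebra k M] [DivisionRing K]
    [Module K M] [FiniteDimensional K M] (hc : ∀ (c : K) (m x : M), c • (m * x) = m * (c • x))
    (hk : ∀ a : k, ∃ c : K, ∀ x : M, a • x = c • x)
    (V : Submodule k M)
    (hVgen : Subfield.closure (Set.range (algebraMap k M) ∪ (V : Set M)) = ⊤)
    (N : Submodule K M) (h1 : (1 : M) ∈ N) (hVN : ∀ v ∈ V, ∀ x ∈ N, v * x ∈ N) : N = ⊤ := by
  let F : Subfield M :=
    { carrier := {m | ∀ x ∈ N, m * x ∈ N}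
      mul_mem' := by
        intro a b ha hb x hx
        rw [mul_assoc]
        exact ha _ (hb _ hx)
      one_mem' := by
        intro x hx
        simpa using hx
      add_mem' := by
        intro a b ha hb x hx
        rw [add_mul]
        exact N.add_mem (ha _ hx) (hb _ hx)
      zero_mem' := by
        intro x hx
        simp
      neg_mem' := by
        intro a ha x hx
        rw [neg_mul]
        exact N.neg_mem (ha _ hx)
      inv_mem' := by
        intro a ha x hx
        by_cases h0 : a = 0
        · simp [h0]
        let f : N →ₗ[K] N :=
          { toFun := fun y => ⟨a * y, ha _ y.2⟩
            map_add' := by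
              intro y z
              ext
              simp [mul_add]
            map_smul' := by
              intro c y
              ext
              simp [hc] }
        have hinj : Function.Injective f := by
          intro y z hyz
          have : a * (y : M) = a * z := congrArg Subtype.val hyz
          exact Subtype.ext (mul_left_cancel₀ h0 this)
        obtain ⟨y, hy⟩ := LinearMap.injective_iff_surjective.mp hinj ⟨x, hx⟩
        have hy' : a * (y : M) = x := congrArg Subtype.val hy
        rw [← hy', inv_mul_cancel_left₀ h0]
        exact y.2 }
  have hF : F = ⊤ := by
    rw [eq_top_iff, ← hVgen, Subfield.closure_le]
    rintro m (⟨a, rfl⟩ | hm)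
    · intro x hx
      obtain ⟨c, hcx⟩ := hk a
      rw [← Algebra.smul_def, hcx]
      exact N.smul_mem _ hx
    · exact hVN m hm
  rw [eq_top_iff]
  intro m _
  have : m ∈ F := by rw [hF]; trivial
  simpa using this 1 h1

theorem aux_step {K M k : Type*} [Field k] [DivisionRing M] [Algebra k M] [DivisionRing K]
    [Module K M] [FiniteDimensional K M] (hc : ∀ (c : K) (m x : M), c • (m * x) = m * (c • x))
    (hk : ∀ a : k, ∃ c : K, ∀ x : M, a • x = c • x)
    (V : Submodule k M)
    (hVgen : Subfield.closure (Set.range (algebraMap k M) ∪ (V : Set M)) = ⊤) (n : ℕ)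
    (hn : n + 1 ≤ Module.finrank K M) :
    ∃ S : Finset M, S.card = n + 1 ∧ LinearIndepOn K id (S : Set M) ∧ (1 : M) ∈ S ∧
      ∀ s ∈ S, s = 1 ∨ ∃ v ∈ V, ∃ t ∈ S, s = v * t := by
  classical
  induction n with
  | zero =>
    refine ⟨{1}, by simp, ?_, by simp, by simp⟩
    simp
  | succ n ih =>
    obtain ⟨S, hcard, hli, h1, hS⟩ := ih (by omega)
    by_cases h : ∃ v ∈ V, ∃ t ∈ S, v * t ∉ Submodule.span K (S : Set M)
    · obtain ⟨v, hv, t, ht, hvt⟩ := h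
      have hnot : v * t ∉ S := fun h => hvt (Submodule.subset_span h)
      refine ⟨insert (v * t) S, by rw [Finset.card_insert_of_notMem hnot, hcard], ?_,
        Finset.mem_insert_of_mem h1, ?_⟩
      · rw [Finset.coe_insert]
        exact hli.insert (by simpa using hvt)
      · intro s hs
        rcases Finset.mem_insert.mp hs with rfl | hs
        · exact Or.inr ⟨v, hv, t, Finset.mem_insert_of_mem ht, rfl⟩
        · rcases hS s hs with h | ⟨v', hv', t', ht', h⟩
          · exact Or.inl h
          · exact Or.inr ⟨v', hv', t', Finset.mem_insert_of_mem ht', h⟩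
    · exfalso
      push Not at h
      have htop := aux_full hc hk V hVgen (Submodule.span K (S : Set M))
        (Submodule.subset_span h1) (by
          intro v hv x hx
          induction hx using Submodule.span_induction with
          | mem x hx => exact h v hv x hx
          | zero => simp
          | add x y _ _ hx hy =>
            rw [mul_add]
            exact Submodule.add_mem _ hx hy
          | smul c x _ hx =>
            rw [← hc]
            exact Submodule.smul_mem _ _ hx)
      have := finrank_span_finset_le_card (R := K) S
      rw [Set.finrank, htop, finrank_top] at this
      omega

/-- **Proposition (existence of a good spanning subspace `W`).**
Let `L ⊆ M` be skew fields over `k`, let `V ⊆ M` be a finite-dimensional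
`k`-subspace generating `M` as a skew field over `k`, and suppose `M` has a right
`L`-basis of size `d` (i.e. `dim M_L = d` is finite). Then there is a `k`-subspace
`W` of `M` with `dim_k W = d`, such that a `k`-basis of `W` is a right `L`-basis of
`M` (in particular `W·L = M`), `1 ∈ W`, and `W ⊆ k·1 + V·W`. -/
theorem exists_good_subspace
    (k M : Type*) [Field k] [DivisionRing M] [Algebra k M]
    (L : Subfield M) (hkL : Set.range (algebraMap k M) ⊆ (L : Set M))
    (V : Submodule k M) (hVfin : FiniteDimensional k V)
    (hVgen : Subfield.closure (Set.range (algebraMap k M) ∪ (V : Set M)) = ⊤)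
    (d : ℕ) (u : Fin d → M)
    -- `u` is a basis of `M` as a right `L`-vector space:
    (huspan : ∀ x : M, ∃ c : Fin d → M, (∀ i, c i ∈ L) ∧ x = ∑ i, u i * c i)
    (huind : ∀ c : Fin d → M, (∀ i, c i ∈ L) → ∑ i, u i * c i = 0 → ∀ i, c i = 0) :
    ∃ W : Submodule k M, ∃ w : Fin d → M,
      -- `w` is a `k`-basis of `W`, so `dim_k W = d` :
      (∀ i, w i ∈ W) ∧ Submodule.span k (Set.range w) = W ∧ LinearIndependent k w ∧
      -- `w` is a right `L`-basis of `M`, so the right `L`-submodule generated by `W` is `M` :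
      (∀ x : M, ∃ c : Fin d → M, (∀ i, c i ∈ L) ∧ x = ∑ i, w i * c i) ∧
      (∀ c : Fin d → M, (∀ i, c i ∈ L) → ∑ i, w i * c i = 0 → ∀ i, c i = 0) ∧
      -- `1 ∈ W` and `W ⊆ k·1 + V·W` :
      (1 : M) ∈ W ∧ W ≤ 1 ⊔ V * W := by
  let K := (L)ᵐᵒᵖ
  letI modK : Module K M := Module.compHom M (RingHom.op L.subtype)
  have smul_eq : ∀ (c : K) (x : M), c • x = x * (c.unop : M) := fun c x => rfl
  have hli : LinearIndependent K u := by
    rw [Fintype.linearIndependent_iff]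
    intro g hg i
    have := huind (fun i => ((g i).unop : M)) (fun i => (g i).unop.2) hg i
    exact MulOpposite.unop_injective (Subtype.ext this)
  have hsp : ⊤ ≤ Submodule.span K (Set.range u) := by
    intro x _
    obtain ⟨c, hc, rfl⟩ := huspan x
    refine Submodule.sum_mem _ fun i _ => ?_
    exact Submodule.smul_mem _ (MulOpposite.op (⟨c i, hc i⟩ : L))
      (Submodule.subset_span ⟨i, rfl⟩)
  let b := Module.Basis.mk hli hsp
  haveI : FiniteDimensional K M := b.finiteDimensional_of_finite
  have hfr : Module.finrank K M = d := by
    rw [Module.finrank_eq_card_basis b, Fintype.card_fin]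
  have hpos : 0 < d := by
    rw [← hfr]
    exact Module.finrank_pos
  have hc : ∀ (c : K) (m x : M), c • (m * x) = m * (c • x) := fun c m x => by
    rw [smul_eq, smul_eq, mul_assoc]
  have hk : ∀ a : k, ∃ c : K, ∀ x : M, a • x = c • x := fun a =>
    ⟨MulOpposite.op ⟨algebraMap k M a, hkL ⟨a, rfl⟩⟩, fun x => by
      rw [smul_eq, Algebra.smul_def, Algebra.commutes]
      rfl⟩
  obtain ⟨S, hcard, hSli, h1, hS⟩ := aux_step hc hk V hVgen (d - 1) (by omega)
  have hcard' : S.card = d := by omega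
  let e : Fin d ≃ S := (S.equivFinOfCardEq hcard').symm
  let w : Fin d → M := fun i => (e i : M)
  have hrange : Set.range w = S := by
    ext x
    constructor
    · rintro ⟨i, rfl⟩
      exact (e i).2
    · intro hx
      exact ⟨e.symm ⟨x, hx⟩, by simp [w]⟩
  have hwli : LinearIndependent K w := LinearIndependent.comp hSli e e.injective
  have hwind : ∀ c : Fin d → M, (∀ i, c i ∈ L) → ∑ i, w i * c i = 0 → ∀ i, c i = 0 := by
    intro c hcL h0 i
    have := Fintype.linearIndependent_iff.mp hwli
      (fun i => MulOpposite.op (⟨c i, hcL i⟩ : L)) h0 i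
    exact congrArg (fun z : K => (z.unop : M)) this
  refine ⟨Submodule.span k (Set.range w), w, fun i => Submodule.subset_span ⟨i, rfl⟩, rfl,
    ?_, ?_, hwind, ?_, ?_⟩
  · rw [Fintype.linearIndependent_iff]
    intro g hg i
    have := hwind (fun i => algebraMap k M (g i)) (fun i => hkL ⟨g i, rfl⟩) (by
      rw [← hg]
      refine Finset.sum_congr rfl fun i _ => ?_
      rw [Algebra.smul_def, Algebra.commutes]) i
    simpa using this
  · intro x
    have htop := hwli.span_eq_top_of_card_eq_finrank' (by rw [hfr, Fintype.card_fin])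
    have hx : x ∈ Submodule.span K (Set.range w) := by rw [htop]; trivial
    obtain ⟨c, hcx⟩ := (Submodule.mem_span_range_iff_exists_fun K).mp hx
    exact ⟨fun i => ((c i).unop : M), fun i => (c i).unop.2, hcx.symm⟩
  · rw [hrange]
    exact Submodule.subset_span h1
  · rw [hrange, Submodule.span_le]
    intro s hs
    rcases hS s hs with rfl | ⟨v, hv, t, ht, rfl⟩
    · exact Submodule.mem_sup_left (Submodule.one_le.mp le_rfl)
    · exact Submodule.mem_sup_right (Submodule.mul_mem_mul hv (Submodule.subset_span ht))
end

section
/- Let G be a finite group acting faithfully by k-algebra automorphisms on a skew field M, and let L = M^G. Then the dimension of M as a right L-vector space is at most |G|, and the dimension of M as a left L-vector space is at most |G|. In particular, any |G|+1 elements of M are right L-linearly dependent, and likewise left L-linearly dependent. -/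
/-- Left version, for a family of ring automorphisms indexed by a finite group. -/
theorem left_dependent_aux {D G : Type*} [DivisionRing D] [Group G] [Fintype G]
    (φ : G → (D ≃+* D)) (h1 : ∀ x, φ 1 x = x) (hmul : ∀ g h x, φ (g * h) x = φ g (φ h x))
    (f : Fin (Fintype.card G + 1) → D) :
    ∃ c : Fin (Fintype.card G + 1) → D,
      (∀ i, ∀ g : G, φ g (c i) = c i) ∧ (∃ i, c i ≠ 0) ∧ ∑ i, c i * f i = 0 := by
  classical
  let P : (Fin (Fintype.card G + 1) → D) → Prop := fun c =>
    (∃ i, c i ≠ 0) ∧ ∀ g, ∑ i, c i * φ g (f i) = 0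
  have hex : ∃ c, P c := by
    have hli : ¬ LinearIndependent D (fun (i : Fin (Fintype.card G + 1)) (g : G) => φ g (f i)) := by
      intro h
      have := h.fintype_card_le_finrank
      simp at this
    rw [Fintype.not_linearIndependent_iff] at hli
    obtain ⟨c, hc, hi⟩ := hli
    refine ⟨c, hi, fun g => ?_⟩
    have := congrFun hc g
    simpa [Finset.sum_apply] using this
  let m : (Fin (Fintype.card G + 1) → D) → ℕ := fun c => (Finset.univ.filter (fun i => c i ≠ 0)).card
  obtain ⟨c₀, ⟨⟨i₀, hi₀⟩, hs₀⟩, hmin⟩ : ∃ c, P c ∧ ∀ d, P d → m c ≤ m d := by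
    have hne : ∃ n, ∃ c, P c ∧ m c = n := hex.elim fun c hc => ⟨_, c, hc, rfl⟩
    obtain ⟨c, hc, hn⟩ := Nat.find_spec hne
    exact ⟨c, hc, fun d hd => hn ▸ Nat.find_min' hne ⟨d, hd, rfl⟩⟩
  let c : Fin (Fintype.card G + 1) → D := fun i => (c₀ i₀)⁻¹ * c₀ i
  have hc1 : c i₀ = 1 := inv_mul_cancel₀ hi₀
  have hs : ∀ g, ∑ i, c i * φ g (f i) = 0 := by
    intro g
    simp only [c, mul_assoc, ← Finset.mul_sum, hs₀, mul_zero]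
  have hfix : ∀ i, ∀ g : G, φ g (c i) = c i := by
    intro j h
    by_contra hj
    have hP : P (fun i => φ h (c i) - c i) := by
      refine ⟨⟨j, sub_ne_zero.2 hj⟩, fun g => ?_⟩
      have h2 := congrArg (φ h) (hs (h⁻¹ * g))
      simp only [map_sum, map_mul, map_zero, ← hmul, mul_inv_cancel_left] at h2
      simp only [sub_mul, Finset.sum_sub_distrib, h2, hs, sub_zero]
    refine absurd (hmin _ hP) (not_le.2 (Finset.card_lt_card ?_))
    rw [Finset.ssubset_iff_of_subset]
    · exact ⟨i₀, by simpa using hi₀, by simp [hc1]⟩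
    · intro i hi
      simp only [Finset.mem_filter, Finset.mem_univ, true_and] at hi ⊢
      intro h0
      exact hi (by simp [c, h0])
  refine ⟨c, hfix, ⟨i₀, by simp [hc1]⟩, ?_⟩
  simpa [h1] using hs 1

/-- **Lemma (bound on the degree of `M` over `M^G`).**
Let `G` be a finite group acting faithfully by `k`-algebra automorphisms on a skew
field `M`, and `L = M^G`. Then `dim M_L ≤ |G|` and `dim _L M ≤ |G|`: any `|G|+1`
elements of `M` are right `L`-linearly dependent, and left `L`-linearly
dependent. -/
theorem invariants_dimension_le
    (k M : Type*) [Field k] [DivisionRing M] [Algebra k M]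
    (G : Type*) [Group G] [Fintype G]
    (φ : G →* (M ≃ₐ[k] M)) (hφ : Function.Injective φ) :
    (∀ f : Fin (Fintype.card G + 1) → M,
      ∃ c : Fin (Fintype.card G + 1) → M,
        (∀ i, ∀ g : G, φ g (c i) = c i) ∧ (∃ i, c i ≠ 0) ∧ ∑ i, f i * c i = 0) ∧
    (∀ f : Fin (Fintype.card G + 1) → M,
      ∃ c : Fin (Fintype.card G + 1) → M,
        (∀ i, ∀ g : G, φ g (c i) = c i) ∧ (∃ i, c i ≠ 0) ∧ ∑ i, c i * f i = 0) := by
  constructor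
  · intro f
    obtain ⟨c, hc, ⟨i, hi⟩, hs⟩ := left_dependent_aux (D := Mᵐᵒᵖ) (G := G)
      (fun g => RingEquiv.op (φ g).toRingEquiv)
      (fun x => by simp [RingEquiv.op]) (fun g h x => by simp [RingEquiv.op])
      (fun i => MulOpposite.op (f i))
    refine ⟨fun i => (c i).unop, fun i g => ?_, ⟨i, by simpa using hi⟩, ?_⟩
    · exact congrArg MulOpposite.unop (hc i g)
    · simpa using congrArg MulOpposite.unop hs
  · intro f
    exact left_dependent_aux (fun g => (φ g).toRingEquiv) (fun x => by simp)
      (fun g h x => by simp) f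
end

section
/- Let G be a finite group acting faithfully by k-algebra automorphisms on a skew field M, such that the identity is the only element of G acting as an inner automorphism, and let L = M^G. Then there exists x ∈ M such that the family (x^g)_{g∈G} is a basis of M as a right L-vector space; in particular, the dimension of M as a right L-vector space and the dimension of M as a left L-vector space both equal |G|. -/
section KS
variable {R : Type*} [Ring R]

/-- trace of `K` in `X` -/
def nbTr (R : Type*) [Ring R] (K X : Type*) [AddCommGroup K] [Module R K] [AddCommGroup X] [Module R X] :
    Submodule R X := ⨆ g : K →ₗ[R] X, LinearMap.range g

variable {K X Y : Type*} [AddCommGroup K] [Module R K] [AddCommGroup X] [Module R X]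
  [AddCommGroup Y] [Module R Y]

lemma nbTr_mem (g : K →ₗ[R] X) (k : K) : g k ∈ nbTr R K X :=
  (le_iSup (fun g : K →ₗ[R] X => LinearMap.range g) g) ⟨k, rfl⟩

lemma nbTr_le {p : Submodule R X} (h : ∀ (g : K →ₗ[R] X) k, g k ∈ p) : nbTr R K X ≤ p := by
  refine iSup_le fun g => ?_
  rintro _ ⟨k, rfl⟩
  exact h g k

lemma nbTr_map (f : X →ₗ[R] Y) {x : X} (hx : x ∈ nbTr R K X) : f x ∈ nbTr R K Y := by
  have : nbTr R K X ≤ (nbTr R K Y).comap f := nbTr_le fun g k => nbTr_mem (f ∘ₗ g) k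
  exact this hx

noncomputable def nbTrEquiv (e : X ≃ₗ[R] Y) : nbTr R K X ≃ₗ[R] nbTr R K Y :=
  LinearEquiv.ofSubmodules e _ _ (by
    apply le_antisymm
    · rintro _ ⟨x, hx, rfl⟩
      exact nbTr_map e.toLinearMap hx
    · intro y hy
      exact ⟨e.symm y, nbTr_map e.symm.toLinearMap hy, by simp⟩)

noncomputable def nbTrPi (ι : Type*) [Fintype ι] [DecidableEq ι] :
    nbTr R K (ι → X) ≃ₗ[R] (ι → nbTr R K X) where
  toFun x i := ⟨x.1 i, nbTr_map (LinearMap.proj i) x.2⟩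
  invFun y := ⟨fun i => (y i).1, by
    have : (fun i => (y i).1) = ∑ i, LinearMap.single R (fun _ => X) i (y i).1 := by
      simp [LinearMap.sum_single_apply, LinearMap.coe_single]
    rw [this]
    exact Submodule.sum_mem _ fun i _ => nbTr_map (LinearMap.single R (fun _ => X) i) (y i).2⟩
  map_add' _ _ := rfl
  map_smul' _ _ := rfl
  left_inv _ := rfl
  right_inv _ := rfl

lemma nb_len_eq {ι : Type*} [Fintype ι] [Nonempty ι] (e : (ι → X) ≃ₗ[R] (ι → Y)) :
    Module.length R X = Module.length R Y := by
  have := e.length_eq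
  rw [Module.length_pi, Module.length_pi] at this
  have hc : (Fintype.card ι : ℕ∞) ≠ 0 := by simp
  simp only [ENat.card_eq_coe_fintype_card] at this
  exact (ENat.mul_right_strictMono hc (by simp)).injective this

lemma nb_semisimple [IsSemisimpleModule R X] [IsSemisimpleModule R Y]
    [IsArtinian R X] [IsNoetherian R X] [IsArtinian R Y] [IsNoetherian R Y]
    {ι : Type*} [Fintype ι] [Nonempty ι] (e : (ι → X) ≃ₗ[R] (ι → Y)) :
    ∃ f : X →ₗ[R] Y, Function.Surjective f := by
  classical
  obtain ⟨_, ⟨f, rfl⟩, hmin⟩ := IsWellFounded.wf.has_min (r := (· < · : Submodule R X → Submodule R X → Prop))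
    (Set.range fun f : X →ₗ[R] Y => LinearMap.ker f) ⟨_, 0, rfl⟩
  refine ⟨f, ?_⟩
  by_contra hs
  have hr : LinearMap.range f ≠ ⊤ := fun h => hs (LinearMap.range_eq_top.1 h)
  obtain ⟨C, hC⟩ := exists_isCompl (LinearMap.range f)
  set K := LinearMap.ker f with hK
  -- no homs from K to C
  have hzero : ∀ g : K →ₗ[R] C, g = 0 := by
    intro g
    obtain ⟨h, hh⟩ := IsSemisimpleModule.extension_property K.subtype K.injective_subtype g
    have hker : LinearMap.ker (f + C.subtype ∘ₗ h) ≤ K ⊓ LinearMap.ker h := by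
      intro x hx
      have hx' : f x + (h x : Y) = 0 := hx
      have h1 : (h x : Y) ∈ LinearMap.range f := by
        rw [← neg_eq_of_add_eq_zero_right hx']
        exact neg_mem ⟨x, rfl⟩
      have h2 : (h x : Y) = 0 := Submodule.disjoint_def.1 hC.disjoint _ h1 (h x).2
      refine ⟨?_, ?_⟩
      · rw [h2, add_zero] at hx'; exact hx'
      · exact Subtype.ext h2
    have hle : ¬ LinearMap.ker (f + C.subtype ∘ₗ h) < K := hmin _ ⟨_, rfl⟩
    have heq : LinearMap.ker (f + C.subtype ∘ₗ h) = K :=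
      (lt_or_eq_of_le (hker.trans inf_le_left)).resolve_left hle
    ext k
    have : (k : X) ∈ K ⊓ LinearMap.ker h := hker (by rw [heq]; exact k.2)
    have h3 : h k = 0 := this.2
    rw [← hh]
    simp [h3]
  have hrange : ∀ (g : K →ₗ[R] Y) k, g k ∈ LinearMap.range f := by
    intro g k
    have := hzero (Submodule.projectionOnto C _ hC.symm ∘ₗ g)
    have h2 := LinearMap.congr_fun this k
    simpa using h2
  let F : nbTr R K X →ₗ[R] nbTr R K Y :=
    (f ∘ₗ (nbTr R K X).subtype).codRestrict _ (fun x => nbTr_map f x.2)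
  have hKle : K ≤ nbTr R K X := fun x hx => nbTr_mem K.subtype ⟨x, hx⟩
  have hFs : Function.Surjective F := by
    have : nbTr R K Y ≤ (nbTr R K X).map f := by
      refine nbTr_le fun g k => ?_
      obtain ⟨h, hh⟩ := IsSemisimpleModule.lifting_property f.rangeRestrict
        f.surjective_rangeRestrict (g.codRestrict _ (hrange g))
      refine ⟨h k, nbTr_mem h k, ?_⟩
      have := congrArg Subtype.val (LinearMap.congr_fun hh k)
      simpa using this
    rintro ⟨y, hy⟩
    obtain ⟨x, hx, rfl⟩ := this hy
    exact ⟨⟨x, hx⟩, rfl⟩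
  have hex : Function.Exact (Submodule.inclusion hKle) F := by
    intro x
    constructor
    · intro h
      exact ⟨⟨x.1, congrArg Subtype.val h⟩, rfl⟩
    · rintro ⟨k, rfl⟩
      exact Subtype.ext k.2
  have hlen := Module.length_eq_add_of_exact _ F (Submodule.inclusion_injective hKle) hFs hex
  have heq : Module.length R (nbTr R K X) = Module.length R (nbTr R K Y) :=
    nb_len_eq (ι := ι) ((nbTrPi ι).symm ≪≫ₗ nbTrEquiv e ≪≫ₗ nbTrPi ι)
  have hK0 : Module.length R K = 0 := by
    have hne : Module.length R (nbTr R K Y) ≠ ⊤ := Module.length_ne_top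
    rw [heq] at hlen
    have h2 : Module.length R (nbTr R K Y) + 0 = Module.length R (nbTr R K Y) + Module.length R K := by
      rw [add_zero, add_comm]; exact hlen
    exact ((ENat.addLECancellable_of_ne_top hne).inj.1 h2).symm
  rw [Module.length_eq_zero_iff, Submodule.subsingleton_iff_eq_bot] at hK0
  have hinj : Function.Injective f := LinearMap.ker_eq_bot.1 hK0
  have h1 := (LinearEquiv.ofInjective f hinj).length_eq
  have h2 := Submodule.length_lt hr
  rw [← h1, nb_len_eq e] at h2
  exact lt_irrefl _ h2

lemma nb_jac_pi {ι : Type*} [Fintype ι] [DecidableEq ι] :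
    Submodule.pi Set.univ (fun _ : ι => Module.jacobson R X) = Module.jacobson R (ι → X) := by
  refine le_antisymm ?_ (Module.jacobson_pi_le R _)
  intro y hy
  have : y = ∑ i, LinearMap.single R (fun _ => X) i (y i) := by
      simp [LinearMap.coe_single, Finset.univ_sum_single]
  rw [this]
  exact Submodule.sum_mem _ fun i _ =>
    Module.map_jacobson_le (LinearMap.single R (fun _ => X) i) ⟨_, hy i trivial, rfl⟩

noncomputable def nbQuotPi (R : Type*) [Ring R] (X : Type*) [AddCommGroup X] [Module R X]
    (ι : Type*) [Fintype ι] [DecidableEq ι] :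
    ((ι → X) ⧸ Module.jacobson R (ι → X)) ≃ₗ[R] (ι → X ⧸ Module.jacobson R X) :=
  let q : (ι → X) →ₗ[R] (ι → X ⧸ Module.jacobson R X) :=
    LinearMap.pi fun i => (Module.jacobson R X).mkQ ∘ₗ LinearMap.proj i
  have hq : Function.Surjective q := fun y =>
    ⟨fun i => (Submodule.mkQ_surjective _ (y i)).choose,
      funext fun i => (Submodule.mkQ_surjective _ (y i)).choose_spec⟩
  have hk : Module.jacobson R (ι → X) = LinearMap.ker q := by
    rw [← nb_jac_pi]
    ext x
    simp [q, funext_iff, Submodule.mem_pi]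
  Submodule.quotEquivOfEq _ _ hk ≪≫ₗ q.quotKerEquivOfSurjective hq

lemma nb_cyclic [IsArtinianRing R] 
    {ι : Type*} [Fintype ι] [Nonempty ι] (e : (ι → R) ≃ₗ[R] (ι → Y)) :
    ∃ y : Y, Submodule.span R {y} = ⊤ := by
  classical
  have i : Nonempty ι := inferInstance
  have : Module.Finite R (ι → Y) := Module.Finite.equiv e
  have : Module.Finite R Y := Module.Finite.of_surjective (LinearMap.proj (R := R) (φ := fun _ : ι => Y) i.some)
    (fun y => ⟨fun _ => y, rfl⟩)
  have e1 := Submodule.Quotient.equiv (Module.jacobson R (ι → R)) (Module.jacobson R (ι → Y)) e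
    (Module.map_jacobson_of_bijective (f := e.toLinearMap) e.bijective)
  have e2 := (nbQuotPi R R ι).symm ≪≫ₗ e1 ≪≫ₗ nbQuotPi R Y ι
  have : IsSemisimpleModule R (R ⧸ Module.jacobson R R) :=
    (IsArtinian.isSemisimpleModule_iff_jacobson _ _).2 (Module.jacobson_quotient_jacobson _ _)
  have : IsSemisimpleModule R (Y ⧸ Module.jacobson R Y) :=
    (IsArtinian.isSemisimpleModule_iff_jacobson _ _).2 (Module.jacobson_quotient_jacobson _ _)
  obtain ⟨f, hf⟩ := nb_semisimple e2
  obtain ⟨y, hy⟩ := Submodule.mkQ_surjective _ (f (Submodule.mkQ _ 1))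
  refine ⟨y, ?_⟩
  by_contra hne
  obtain ⟨m, hm, hle⟩ := (eq_top_or_exists_le_coatom (Submodule.span R {y})).resolve_left hne
  have hj : Module.jacobson R Y ≤ m := sInf_le hm
  apply hm.1
  rw [eq_top_iff]
  intro z _
  obtain ⟨r, hr⟩ := hf (Submodule.mkQ _ z)
  obtain ⟨r, rfl⟩ := Submodule.mkQ_surjective _ r
  have h1 : Submodule.mkQ (Module.jacobson R Y) z = Submodule.mkQ _ (r • y) := by
    rw [map_smul, hy, ← map_smul, ← map_smul, smul_eq_mul, mul_one, hr]
  have h2 : z - r • y ∈ m := hj ((Submodule.Quotient.eq _).1 h1)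
  have h3 : r • y ∈ m := m.smul_mem _ (hle (Submodule.mem_span_singleton_self y))
  simpa using m.add_mem h2 h3
end KS

section Left
variable {D : Type*} [DivisionRing D] {G : Type*} [Group G] [Fintype G]

/-- The division subring of invariants. -/
def nbFix (φ : G →* (D ≃+* D)) : Subfield D where
  carrier := {d | ∀ g, φ g d = d}
  mul_mem' ha hb g := by rw [map_mul, ha g, hb g]
  one_mem' g := map_one _
  add_mem' ha hb g := by rw [map_add, ha g, hb g]
  zero_mem' g := map_zero _
  neg_mem' ha g := by rw [map_neg, ha g]
  inv_mem' x hx g := by rw [map_inv₀, hx g]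

lemma nb_dedekind (φ : G →* (D ≃+* D))
    (hout : ∀ (g : G) (u : D), u ≠ 0 → (∀ a : D, φ g a = u * a * u⁻¹) → g = 1)
    (b : G → D) (hb : ∀ y, ∑ g, φ g y * b g = 0) : b = 0 := by
  classical
  induction hn : (Finset.univ.filter fun g => b g ≠ 0).card using Nat.strong_induction_on
    generalizing b with
  | _ n ih =>
  by_contra hne
  obtain ⟨g0, h0⟩ := Function.ne_iff.1 hne
  have h0 : b g0 ≠ 0 := h0
  have key : ∀ z g, φ g z * b g = b g * (b g0)⁻¹ * φ g0 z * b g0 := by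
    intro z g
    have := ih _ ?_ (fun g => φ g z * b g - b g * (b g0)⁻¹ * φ g0 z * b g0) ?_ rfl
    · exact sub_eq_zero.1 (congrFun this g)
    · rw [← hn]
      apply Finset.card_lt_card
      refine (Finset.ssubset_iff_of_subset ?_).2 ⟨g0, by simpa using h0, ?_⟩
      · intro g hg
        simp only [Finset.mem_filter, Finset.mem_univ, true_and] at hg ⊢
        intro h
        apply hg
        simp [h]
      · simp [h0]
    · intro y
      have h1 := hb (y * z)
      have h2 := congrArg (· * ((b g0)⁻¹ * φ g0 z * b g0)) (hb y)
      simp only [zero_mul, Finset.sum_mul] at h2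
      simp only [mul_sub, Finset.sum_sub_distrib]
      rw [sub_eq_zero]
      trans (0 : D)
      · rw [← h1]
        simp [mul_assoc]
      · rw [← h2]
        simp [mul_assoc]
  have hz : ∀ g, g ≠ g0 → b g = 0 := by
    intro g hg
    by_contra hbg
    apply hg
    have := hout (g * g0⁻¹) (b g * (b g0)⁻¹) (mul_ne_zero hbg (inv_ne_zero h0)) ?_
    · exact mul_inv_eq_one.1 this
    · intro a
      have := key ((φ g0)⁻¹ a) g
      have h2 : φ g0 ((φ g0)⁻¹ a) = a := (φ g0).apply_symm_apply a
      rw [h2] at this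
      rw [map_mul, map_inv, mul_inv_rev, inv_inv]
      change φ g ((φ g0)⁻¹ a) = _
      rw [← mul_assoc, ← this, mul_assoc, mul_inv_cancel₀ hbg, mul_one]
  have := hb 1
  rw [Finset.sum_eq_single g0 (fun g _ hg => by simp [hz g hg]) (by simp)] at this
  simp [h0] at this

lemma nb_span (φ : G →* (D ≃+* D))
    (hout : ∀ (g : G) (u : D), u ≠ 0 → (∀ a : D, φ g a = u * a * u⁻¹) → g = 1) :
    Submodule.span D (Set.range fun (y : D) (g : G) => φ g y) = ⊤ := by
  classical
  by_contra hne
  obtain ⟨f, hf, hle⟩ := Submodule.exists_le_ker_of_lt_top _ (lt_top_iff_ne_top.2 hne)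
  have hfa : ∀ v : G → D, f v = ∑ g, v g * f (Pi.single g 1) := by
    intro v
    conv_lhs => rw [← Finset.univ_sum_single v]
    rw [map_sum]
    refine Finset.sum_congr rfl fun g _ => ?_
    rw [← smul_eq_mul, ← map_smul, ← Pi.single_smul]
    simp
  have := nb_dedekind φ hout (fun g => f (Pi.single g 1)) fun y => by
    rw [← hfa (fun g => φ g y)]
    exact hle (Submodule.subset_span ⟨y, rfl⟩)
  apply hf
  ext g
  simpa using congrFun this g

/-- action of the group algebra -/
noncomputable def nbHom (φ : G →* (D ≃+* D)) :
    MonoidAlgebra (nbFix φ) G →+* AddMonoid.End D :=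
  MonoidAlgebra.liftNCRingHom (Module.toAddMonoidEnd (nbFix φ) D)
    { toFun := fun g => ((φ g : D →+* D) : D →+ D)
      map_one' := by
        rw [map_one]
        rfl
      map_mul' := fun a b => by
        rw [map_mul]
        rfl }
    (fun l g => by
      ext d
      change (l : D) * φ g d = φ g (l * d)
      rw [map_mul, l.2 g])

lemma nbHom_apply (φ : G →* (D ≃+* D)) (a : MonoidAlgebra (nbFix φ) G) (d : D) :
    nbHom φ a d = ∑ g, (a.coeff g : D) * φ g d := by
  classical
  have h : a = ∑ g, MonoidAlgebra.single g (a.coeff g) := by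
    conv_lhs => rw [← MonoidAlgebra.sum_coeff_single a]
    exact Finsupp.sum_fintype _ _ (by simp)
  have h1 : ∀ g (l : nbFix φ), nbHom φ (MonoidAlgebra.single g l) d = l * φ g d := by
    intro g l
    have h2 : nbHom φ (MonoidAlgebra.single g l) = Module.toAddMonoidEnd (nbFix φ) D l *
        (show AddMonoid.End D from ((φ g : D →+* D) : D →+ D)) := MonoidAlgebra.liftNC_single _ _ _ _
    rw [h2]
    rfl
  conv_lhs => rw [h, map_sum]
  refine (AddMonoidHom.finsetSum_apply _ _ _).trans ?_
  exact Finset.sum_congr rfl fun g _ => h1 g _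

theorem nb_left (φ : G →* (D ≃+* D))
    (hout : ∀ (g : G) (u : D), u ≠ 0 → (∀ a : D, φ g a = u * a * u⁻¹) → g = 1) :
    ∃ x : D,
      (∀ y : D, ∃ c : G → D, (∀ g, ∀ h : G, φ h (c g) = c g) ∧ y = ∑ g, c g * φ g x) ∧
      (∀ c : G → D, (∀ g, ∀ h : G, φ h (c g) = c g) →
        ∑ g, c g * φ g x = 0 → ∀ g, c g = 0) := by
  classical
  obtain ⟨κ, y, -, hsp, hli⟩ := exists_linearIndependent' D (fun (y : D) (g : G) => φ g y)
  rw [nb_span φ hout] at hsp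
  let B : Module.Basis κ D (G → D) := Module.Basis.mk hli hsp.ge
  have : Fintype κ := FiniteDimensional.fintypeBasisIndex B
  have hcard : Fintype.card κ = Fintype.card G := by
    rw [← Module.finrank_eq_card_basis B, Module.finrank_fintype_fun_eq_card]
  have hBa : ∀ j g, B j g = φ g (y j) := fun j g => by simp [B]
  -- Galois coordinates
  let z : κ → D := fun j => B.repr (Pi.single 1 1) j
  have hz : ∀ g, ∑ j, z j * φ g (y j) = if g = 1 then 1 else 0 := by
    intro g
    have := congrFun (B.sum_repr (Pi.single 1 1)) g
    simpa [hBa, Pi.single_apply, z] using this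
  have hz2 : ∀ g h, ∑ j, φ g (z j) * φ h (y j) = if g = h then 1 else 0 := by
    intro g h
    have := congrArg (φ g) (hz (g⁻¹ * h))
    rw [map_sum] at this
    simp only [map_mul, RingAut.mul_apply] at this
    have h3 : ∀ d, φ g (φ g⁻¹ d) = d := fun d => by
      rw [← RingAut.mul_apply, ← map_mul]; simp
    simp only [h3] at this
    rw [this]
    by_cases hgh : g = h
    · simp [hgh]
    · rw [if_neg hgh, if_neg (by rw [inv_mul_eq_one]; exact hgh), map_zero]
  -- `y` is an `L`-basis
  have htr : ∀ d, (∑ g, φ g d) ∈ nbFix φ := by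
    intro d h
    rw [map_sum]
    simp_rw [← RingAut.mul_apply, ← map_mul]
    exact Fintype.sum_equiv (Equiv.mulLeft h) _ _ (fun _ => rfl)
  have hexp : ∀ d, ∑ j, (∑ g, φ g (d * z j)) * y j = d := by
    intro d
    simp_rw [Finset.sum_mul]
    rw [Finset.sum_comm]
    have : ∀ g, ∑ j, φ g (d * z j) * y j = φ g d * if g = 1 then 1 else 0 := by
      intro g
      rw [← hz2 g 1, Finset.mul_sum]
      simp [mul_assoc]
    simp_rw [this]
    simp
  have hyli : LinearIndependent (nbFix φ) y := by
    rw [Fintype.linearIndependent_iff]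
    intro c hc j
    have := Fintype.linearIndependent_iff.1 hli (fun j => (c j : D)) (by
      ext g
      have := congrArg (φ g) hc
      rw [map_sum, map_zero] at this
      simp only [Finset.sum_apply, Pi.smul_apply, Function.comp, smul_eq_mul, Pi.zero_apply]
      rw [← this]
      refine Finset.sum_congr rfl fun j _ => ?_
      rw [Subfield.smul_def, smul_eq_mul, map_mul, (c j).2 g]) j
    exact Subtype.ext this
  have hysp : ⊤ ≤ Submodule.span (nbFix φ) (Set.range y) := by
    intro d _
    rw [← hexp d]
    exact Submodule.sum_mem _ fun j _ =>
      Submodule.smul_mem _ (⟨_, htr (d * z j)⟩ : nbFix φ) (Submodule.subset_span ⟨j, rfl⟩)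
  let b : Module.Basis κ (nbFix φ) D := Module.Basis.mk hyli hysp
  have hdual : ∀ i j, ∑ g, φ g (y i * z j) = if i = j then 1 else 0 := by
    intro i j
    have h1 := hexp (y i)
    have h2 := Fintype.linearIndependent_iff.1 hyli
      (fun j => (⟨_, htr (y i * z j)⟩ : nbFix φ) - if i = j then 1 else 0) (by
        simp only [sub_smul, Finset.sum_sub_distrib, ite_smul, one_smul, zero_smul,
          Finset.sum_ite_eq, Finset.mem_univ, if_true]
        rw [sub_eq_zero]
        exact h1) j
    have h3 := congrArg Subtype.val (sub_eq_zero.1 h2)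
    split_ifs at h3 ⊢ <;> exact h3
  let _ : Module (MonoidAlgebra (nbFix φ) G) D := Module.compHom D (nbHom φ)
  have hsm : ∀ (a : MonoidAlgebra (nbFix φ) G) (d : D),
    a • d = ∑ g, (a.coeff g : D) * φ g d := nbHom_apply φ
  have : Module.Finite (nbFix φ) (MonoidAlgebra (nbFix φ) G) :=
    Module.Finite.equiv (MonoidAlgebra.coeffLinearEquiv (S := nbFix φ) (M := G) (nbFix φ)).symm
  have : IsArtinianRing (MonoidAlgebra (nbFix φ) G) :=
    isArtinian_of_tower (nbFix φ) inferInstance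
  let f : (κ → MonoidAlgebra (nbFix φ) G) →ₗ[MonoidAlgebra (nbFix φ) G] (κ → D) :=
    Fintype.linearCombination _ (fun i j => y i * z j)
  have hf : ∀ a j, f a j = ∑ i, ∑ g, ((a i).coeff g : D) * φ g (y i * z j) := by
    intro a j
    simp only [f, Fintype.linearCombination_apply, Finset.sum_apply, Pi.smul_apply]
    exact Finset.sum_congr rfl fun i _ => hsm _ _
  have hinj : Function.Injective f := by
    rw [injective_iff_map_eq_zero]
    intro a ha
    have h1 : ∀ h, ∑ i, ((a i).coeff h : D) * y i = 0 := by
      intro h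
      have h2 : ∑ j, f a j * φ h (y j) = 0 := by simp [ha]
      have h3 : ∑ j, f a j * φ h (y j) = ∑ i, ((a i).coeff h : D) * φ h (y i) := by
        simp_rw [hf, Finset.sum_mul]
        rw [Finset.sum_comm]
        refine Finset.sum_congr rfl fun i _ => ?_
        rw [Finset.sum_comm]
        have : ∀ g, ∑ j, ((a i).coeff g : D) * φ g (y i * z j) * φ h (y j) =
            (a i).coeff g * φ g (y i) * if g = h then 1 else 0 := by
          intro g
          rw [← hz2, Finset.mul_sum]
          simp [mul_assoc]
        simp_rw [this]
        simp
      rw [h3] at h2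
      apply (φ h).injective
      rw [map_zero, ← h2, map_sum]
      refine Finset.sum_congr rfl fun i _ => ?_
      rw [map_mul, ((a i).coeff h).2 h]
    ext i h
    have := Fintype.linearIndependent_iff.1 hyli (fun i => (a i).coeff h) (h1 h) i
    simpa using this
  have hsurj : Function.Surjective f := by
    intro d
    let a : κ → MonoidAlgebra (nbFix φ) G := fun i =>
      MonoidAlgebra.ofCoeff (Finsupp.equivFunOnFinite.symm fun g => b.repr (∑ j, φ g⁻¹ (d j) * y j) i)
    have ha : ∀ g, ∑ i, ((a i).coeff g : D) * y i = ∑ j, φ g⁻¹ (d j) * y j := by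
      intro g
      have := b.sum_repr (∑ j, φ g⁻¹ (d j) * y j)
      simpa [b, a, Subfield.smul_def] using this
    refine ⟨a, funext fun j => ?_⟩
    rw [hf, Finset.sum_comm]
    have h1 : ∀ g, ∑ i, ((a i).coeff g : D) * φ g (y i * z j) = ∑ i, d i * φ g (y i * z j) := by
      intro g
      have h2 := congrArg (fun t => φ g t * φ g (z j)) (ha g)
      simp only [map_sum, map_mul, Finset.sum_mul] at h2
      have h3 : ∀ d, φ g (φ g⁻¹ d) = d := fun d => by
        rw [← RingAut.mul_apply, ← map_mul]; simp
      simp only [h3, mul_assoc] at h2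
      simp only [map_mul]
      rw [← h2]
      exact Finset.sum_congr rfl fun i _ => by rw [((a i).coeff g).2 g]
    simp_rw [h1]
    rw [Finset.sum_comm]
    simp_rw [← Finset.mul_sum, hdual]
    simp
  have : Nonempty κ := Fintype.card_pos_iff.1 (hcard ▸ Fintype.card_pos)
  obtain ⟨x, hx⟩ := nb_cyclic (LinearEquiv.ofBijective f ⟨hinj, hsurj⟩)
  have hspan : ∀ d : D, ∃ c : G → nbFix φ, d = ∑ g, (c g : D) * φ g x := by
    intro d
    have : d ∈ Submodule.span (MonoidAlgebra (nbFix φ) G) {x} := hx ▸ trivial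
    obtain ⟨a, rfl⟩ := Submodule.mem_span_singleton.1 this
    exact ⟨fun g => a.coeff g, hsm a x⟩
  have hind : LinearIndependent (nbFix φ) (fun g => φ g x) := by
    apply linearIndependent_of_top_le_span_of_card_eq_finrank
    · intro d _
      obtain ⟨c, rfl⟩ := hspan d
      exact Submodule.sum_mem _ fun g _ =>
        Submodule.smul_mem _ (c g) (Submodule.subset_span ⟨g, rfl⟩)
    · rw [Module.finrank_eq_card_basis b, hcard]
  refine ⟨x, fun d => ?_, fun c hc h g => ?_⟩
  · obtain ⟨c, hc⟩ := hspan d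
    exact ⟨fun g => c g, fun g => (c g).2, hc⟩
  · exact congrArg Subtype.val
      (Fintype.linearIndependent_iff.1 hind (fun g => (⟨c g, hc g⟩ : nbFix φ)) h g)
end Left

/-- **Lemma (normal basis theorem for outer actions).**
Let `G` be a finite group acting faithfully by `k`-algebra automorphisms on a skew
field `M`, consisting of outer automorphisms, and let `L = M^G`. Then there is
`x ∈ M` such that `(x^g)_{g ∈ G}` is a right `L`-basis of `M`; in particular the
right and the left `L`-dimensions of `M` both equal `|G|` (witnessed below by the
existence of a left `L`-basis indexed by `G` as well). -/
theorem normal_basis_outer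
    (k M : Type*) [Field k] [DivisionRing M] [Algebra k M]
    (G : Type*) [Group G] [Fintype G]
    (φ : G →* (M ≃ₐ[k] M)) (hφ : Function.Injective φ)
    (hout : ∀ (g : G) (u : M), u ≠ 0 → (∀ a : M, φ g a = u * a * u⁻¹) → g = 1) :
    (∃ x : M,
      (∀ y : M, ∃ c : G → M, (∀ g, ∀ h : G, φ h (c g) = c g) ∧ y = ∑ g, φ g x * c g) ∧
      (∀ c : G → M, (∀ g, ∀ h : G, φ h (c g) = c g) →
        ∑ g, φ g x * c g = 0 → ∀ g, c g = 0)) ∧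
    (∃ w : G → M,
      (∀ y : M, ∃ c : G → M, (∀ g, ∀ h : G, φ h (c g) = c g) ∧ y = ∑ g, c g * w g) ∧
      (∀ c : G → M, (∀ g, ∀ h : G, φ h (c g) = c g) →
        ∑ g, c g * w g = 0 → ∀ g, c g = 0)) := by
  constructor
  · let ψ : G →* (Mᵐᵒᵖ ≃+* Mᵐᵒᵖ) :=
      { toFun := fun g => RingEquiv.op (φ g).toRingEquiv
        map_one' := by ext a; simp
        map_mul' := fun a b => by ext c; simp }
    have hψ : ∀ g (a : M), ψ g (MulOpposite.op a) = MulOpposite.op (φ g a) := fun g a => rfl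
    obtain ⟨x, h1, h2⟩ := nb_left ψ (fun g u hu h => by
      apply hout g u.unop⁻¹ (by simpa using hu)
      intro a
      have := congrArg MulOpposite.unop (h (MulOpposite.op a))
      rw [hψ] at this
      simpa [mul_assoc] using this)
    refine ⟨x.unop, fun y => ?_, fun c hc h g => ?_⟩
    · obtain ⟨c, hc, hy⟩ := h1 (MulOpposite.op y)
      refine ⟨fun g => (c g).unop, fun g h => congrArg MulOpposite.unop (hc g h), ?_⟩
      have := congrArg MulOpposite.unop hy
      rw [MulOpposite.unop_op, Finset.unop_sum] at this
      exact this
    · have := h2 (fun g => MulOpposite.op (c g)) (fun g h => by rw [hψ, hc]) (by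
        apply MulOpposite.unop_injective
        rw [Finset.unop_sum]
        exact h) g
      exact MulOpposite.op_injective this
  · let ψ : G →* (M ≃+* M) :=
      { toFun := fun g => (φ g).toRingEquiv
        map_one' := by ext a; simp
        map_mul' := fun a b => by ext c; simp }
    obtain ⟨x, h1, h2⟩ := nb_left ψ hout
    exact ⟨fun g => φ g x, h1, h2⟩
end

section
/- Let G be a finite group acting faithfully by k-algebra automorphisms on a skew field M, let L = M^G, and let d = |G|. Suppose w_1, …, w_d ∈ M are right L-linearly independent (there is no relation Σ_j w_j c_j = 0 with c_j ∈ L not all zero). Then the d×d matrix W = (w_j^g), with rows indexed by g ∈ G and columns by j = 1,…,d, is invertible in the matrix ring of d×d matrices over M. -/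
/-- **Lemma (invertibility of the `G`-matrix of a right `M^G`-independent family).**
Let `G` be a finite group acting faithfully by `k`-algebra automorphisms on a skew
field `M`, let `L = M^G` and `d = |G|`. If `w : G → M` is a family of `d` elements
that is right `L`-linearly independent, then the `d × d` matrix `(w_j^g)_{g,j}`
(rows indexed by `g ∈ G`, columns by `j`) is invertible in the matrix ring over
`M`. -/
theorem G_matrix_invertible
    (k M : Type*) [Field k] [DivisionRing M] [Algebra k M]
    (G : Type*) [Group G] [Fintype G] [DecidableEq G]
    (φ : G →* (M ≃ₐ[k] M)) (hφ : Function.Injective φ)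
    (w : G → M)
    (hind : ∀ c : G → M, (∀ j, ∀ g : G, φ g (c j) = c j) →
      ∑ j, w j * c j = 0 → ∀ j, c j = 0) :
    IsUnit (Matrix.of (fun (g j : G) => φ g (w j)) : Matrix G G M) := by
  classical
  have hmin : ∀ n : ℕ, ∀ c : G → M, (Finset.univ.filter (fun j => c j ≠ 0)).card ≤ n →
      (∀ g, ∑ j, φ g (w j) * c j = 0) → c = 0 := by
    intro n
    induction n with
    | zero =>
      intro c hc _
      funext j
      by_contra hj
      have : j ∈ Finset.univ.filter (fun j => c j ≠ 0) := by simpa using hj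
      rw [Finset.card_eq_zero.mp (Nat.le_zero.mp hc)] at this
      simp at this
    | succ n ih =>
      intro c hc hk
      by_contra hne
      obtain ⟨i, hi⟩ := Function.ne_iff.mp hne
      have hi' : c i ≠ 0 := hi
      have hk' : ∀ g, ∑ j, φ g (w j) * (c j * (c i)⁻¹) = 0 := by
        intro g
        have := congrArg (· * (c i)⁻¹) (hk g)
        simpa [Finset.sum_mul, mul_assoc] using this
      have hfix : ∀ h j, φ h (c j * (c i)⁻¹) = c j * (c i)⁻¹ := by
        intro h
        have h0 : (fun j => φ h (c j * (c i)⁻¹) - c j * (c i)⁻¹) = 0 := by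
          apply ih
          · have hlt : (Finset.univ.filter
                (fun j => φ h (c j * (c i)⁻¹) - c j * (c i)⁻¹ ≠ 0)) ⊂
                Finset.univ.filter (fun j => c j ≠ 0) := by
              rw [Finset.ssubset_iff_of_subset]
              · exact ⟨i, by simpa using hi', by simp [mul_inv_cancel₀ hi', -map_mul]⟩
              · intro j
                simp only [Finset.mem_filter, Finset.mem_univ, true_and]
                intro hj h0
                apply hj
                simp [h0]
            have := Finset.card_lt_card hlt
            omega
          · intro g
            have h1 := congrArg (φ h) (hk' (h⁻¹ * g))
            rw [map_sum, map_zero] at h1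
            have h2 : ∑ j, φ g (w j) * φ h (c j * (c i)⁻¹) = 0 := by
              rw [← h1]
              refine Finset.sum_congr rfl fun j _ => ?_
              rw [map_mul (φ h) (φ (h⁻¹ * g) (w j)), ← AlgEquiv.mul_apply, ← map_mul φ,
                mul_inv_cancel_left]
            simp only [mul_sub, Finset.sum_sub_distrib]
            rw [h2, hk' g, sub_zero]
        intro j
        exact sub_eq_zero.mp (congrFun h0 j)
      have h1 := hind (fun j => c j * (c i)⁻¹) (fun j g => hfix g j)
        (by simpa using hk' 1) i
      simp [hi'] at h1
  set A : Matrix G G M := Matrix.of (fun (g j : G) => φ g (w j)) with hA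
  have hker : ∀ c : G → M, A.mulVec c = 0 → c = 0 := fun c hc =>
    hmin _ c le_rfl (fun g => congrFun hc g)
  let T : (G → M) →ₗ[Mᵐᵒᵖ] (G → M) :=
    { toFun := fun c => A.mulVec c
      map_add' := fun x y => Matrix.mulVec_add A x y
      map_smul' := fun r x => Matrix.mulVec_smul A r x }
  have hinj : Function.Injective T := by
    rw [injective_iff_map_eq_zero]
    exact hker
  have : Module.Finite Mᵐᵒᵖ M := 
    Module.Finite.of_surjective (LinearMap.toSpanSingleton Mᵐᵒᵖ M 1)
      (fun m => ⟨MulOpposite.op m, by simp⟩)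
  have hsurj : Function.Surjective T := LinearMap.injective_iff_surjective.mp hinj
  choose b hb using fun j : G => hsurj (Pi.single j 1)
  have hAB : A * Matrix.of (fun i j => b j i) = 1 := by
    ext i j
    have := congrFun (hb j) i
    rw [Matrix.one_apply]
    rw [Pi.single_apply] at this
    exact this
  have hBA : Matrix.of (fun i j => b j i) * A = 1 := by
    rw [← sub_eq_zero]
    have h0 : A * (Matrix.of (fun i j => b j i) * A - 1) = 0 := by
      rw [mul_sub, ← mul_assoc, hAB, one_mul, mul_one, sub_self]
    ext i j
    exact congrFun (hker (fun i => (Matrix.of (fun i j => b j i) * A - 1) i j)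
      (funext fun g => congrFun (congrFun h0 g) j)) i
  exact ⟨⟨A, _, hAB, hBA⟩, rfl⟩
end

section
/- Let G be a finite group acting faithfully by k-algebra automorphisms on a skew field M, let L = M^G, and let b_1, …, b_ℓ ∈ M with ℓ ≤ |G|. Then b_1, …, b_ℓ are right L-linearly independent (there is no relation Σ_j b_j c_j = 0 with c_j ∈ L not all zero) if and only if the ℓ columns of the |G|×ℓ matrix (b_j^g), rows indexed by g ∈ G and columns by j, are right M-linearly independent as vectors in M^{|G|} (there is no relation Σ_j (b_j^g)_{g∈G}·m_j = 0 with m_j ∈ M not all zero). -/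
/-- **Lemma (right `M^G`-independence via the `G`-matrix).**
Let `G` be a finite group acting faithfully by `k`-algebra automorphisms on a skew
field `M`, let `L = M^G`, and let `b₁, …, b_ℓ ∈ M` with `ℓ ≤ |G|`. Then
`b₁, …, b_ℓ` are right `L`-linearly independent if and only if the `ℓ` columns of
the `|G| × ℓ` matrix `(b_j^g)` are right `M`-linearly independent in `M^{|G|}`. -/
theorem right_independent_iff_G_matrix_columns_independent
    (k M : Type*) [Field k] [DivisionRing M] [Algebra k M]
    (G : Type*) [Group G] [Fintype G]
    (φ : G →* (M ≃ₐ[k] M)) (hφ : Function.Injective φ)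
    (ℓ : ℕ) (hℓ : ℓ ≤ Fintype.card G) (b : Fin ℓ → M) :
    (∀ c : Fin ℓ → M, (∀ j, ∀ g : G, φ g (c j) = c j) →
        ∑ j, b j * c j = 0 → ∀ j, c j = 0) ↔
    (∀ m : Fin ℓ → M, (∀ g : G, ∑ j, φ g (b j) * m j = 0) → ∀ j, m j = 0) := by
  classical
  constructor
  · intro hL
    have key : ∀ n : ℕ, ∀ m : Fin ℓ → M, (Finset.univ.filter (fun j => m j ≠ 0)).card = n →
        (∀ g : G, ∑ j, φ g (b j) * m j = 0) → ∀ j, m j = 0 := by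
      intro n
      induction n using Nat.strong_induction_on with
      | _ n ih =>
        intro m hn hm j₀
        by_contra hj
        -- normalise so that the entry at `j₀` is one
        have hm1 : ∀ g : G, ∑ j, φ g (b j) * (m j * (m j₀)⁻¹) = 0 := by
          intro g
          simp only [← mul_assoc, ← Finset.sum_mul, hm g, zero_mul]
        have hinv : ∀ j, ∀ h : G, φ h (m j * (m j₀)⁻¹) = m j * (m j₀)⁻¹ := by
          intro j h
          refine sub_eq_zero.mp (ih _ ?_
            (fun j => φ h (m j * (m j₀)⁻¹) - m j * (m j₀)⁻¹) rfl ?_ j)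
          · rw [← hn]
            apply Finset.card_lt_card
            rw [Finset.ssubset_iff_of_subset]
            · refine ⟨j₀, by simpa using hj, ?_⟩
              simp only [Finset.mem_filter, not_and, not_not]
              intro _
              rw [mul_inv_cancel₀ hj, map_one, sub_self]
            · intro i hi
              simp only [Finset.mem_filter, Finset.mem_univ, true_and] at hi ⊢
              intro h0
              apply hi
              rw [h0, zero_mul, map_zero, sub_self]
          · intro g
            have h2 := congrArg (φ h) (hm1 (h⁻¹ * g))
            rw [map_sum, map_zero] at h2
            have h3 : ∀ x, φ h (φ (h⁻¹ * g) x) = φ g x := by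
              intro x
              rw [← AlgEquiv.mul_apply, ← map_mul, mul_inv_cancel_left]
            simp only [map_mul (φ h), h3] at h2
            simp only [mul_sub, Finset.sum_sub_distrib, hm1 g, sub_zero, map_mul (φ h)]
            exact h2
        have h1 := hL _ hinv (by simpa using hm1 1) j₀
        rw [mul_inv_cancel₀ hj] at h1
        exact one_ne_zero h1
    intro m hm
    exact key _ m rfl hm
  · intro hM c hc h0
    apply hM c
    intro g
    have h2 := congrArg (φ g) h0
    rw [map_sum, map_zero] at h2
    simpa only [map_mul (φ g), hc] using h2
end

section
/- Let L ⊆ M be skew fields and let S ⊆ M be a nonzero right L-submodule of M that is finite-dimensional as a right L-vector space. Then N = {x ∈ M : xS ⊆ S} is a division subring of M: it is a subring of M, and for every nonzero x ∈ N the inverse x⁻¹ also lies in N (indeed xS = S for every nonzero x ∈ N). -/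
/-- **Lemma (the stabilizer of a finite-dimensional right `L`-submodule is a
division subring).**
Let `L ⊆ M` be skew fields and let `S ⊆ M` be a nonzero right `L`-submodule of `M`
spanned over `L` by finitely many elements. Then `N = {x ∈ M : xS ⊆ S}` is a
division subring of `M`: it is a subring, and every nonzero `x ∈ N` satisfies
`x⁻¹ ∈ N`, indeed `xS = S`. -/
theorem stabilizer_is_division_subring
    (M : Type*) [DivisionRing M] (L : Subfield M)
    (S : Set M) (h0 : (0 : M) ∈ S)
    (hadd : ∀ x ∈ S, ∀ y ∈ S, x + y ∈ S)
    (hmulL : ∀ x ∈ S, ∀ c ∈ L, x * c ∈ S)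
    (hne : ∃ x ∈ S, x ≠ 0)
    (n : ℕ) (w : Fin n → M) (hw : ∀ i, w i ∈ S)
    (hspan : ∀ x ∈ S, ∃ c : Fin n → M, (∀ i, c i ∈ L) ∧ x = ∑ i, w i * c i) :
    (1 : M) ∈ {x : M | ∀ s ∈ S, x * s ∈ S} ∧
    (∀ x ∈ {x : M | ∀ s ∈ S, x * s ∈ S}, ∀ y ∈ {x : M | ∀ s ∈ S, x * s ∈ S},
      x + y ∈ {x : M | ∀ s ∈ S, x * s ∈ S}) ∧
    (∀ x ∈ {x : M | ∀ s ∈ S, x * s ∈ S}, -x ∈ {x : M | ∀ s ∈ S, x * s ∈ S}) ∧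
    (∀ x ∈ {x : M | ∀ s ∈ S, x * s ∈ S}, ∀ y ∈ {x : M | ∀ s ∈ S, x * s ∈ S},
      x * y ∈ {x : M | ∀ s ∈ S, x * s ∈ S}) ∧
    (∀ x ∈ {x : M | ∀ s ∈ S, x * s ∈ S}, x ≠ 0 →
      x⁻¹ ∈ {x : M | ∀ s ∈ S, x * s ∈ S} ∧ (fun s => x * s) '' S = S) := by
  have hneg : ∀ s ∈ S, -s ∈ S := fun s hs => by
    have := hmulL s hs (-1) (L.neg_mem L.one_mem)
    simpa using this
  have key : ∀ x : M, (∀ s ∈ S, x * s ∈ S) → x ≠ 0 → ∀ s ∈ S, ∃ t ∈ S, x * t = s := by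
    intro x hx hx0
    letI : Module (L)ᵐᵒᵖ M := Module.compHom M (RingHom.op L.subtype)
    have hsm : ∀ (c : (L)ᵐᵒᵖ) (m : M), c • m = m * (c.unop : M) := fun c m => rfl
    let P : Submodule (L)ᵐᵒᵖ M :=
      { carrier := S
        add_mem' := fun {a b} ha hb => hadd a ha b hb
        zero_mem' := h0
        smul_mem' := fun c m hm => by
          rw [hsm]
          exact hmulL m hm _ c.unop.2 }
    have hP : P = Submodule.span (L)ᵐᵒᵖ (Set.range w) := by
      apply le_antisymm
      · intro y hy
        obtain ⟨c, hc, rfl⟩ := hspan y hy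
        refine Submodule.sum_mem _ fun i _ => ?_
        have := Submodule.smul_mem (Submodule.span (L)ᵐᵒᵖ (Set.range w))
          (MulOpposite.op (⟨c i, hc i⟩ : L)) (Submodule.subset_span ⟨i, rfl⟩)
        rwa [hsm] at this
      · rw [Submodule.span_le]
        rintro _ ⟨i, rfl⟩
        exact hw i
    haveI : FiniteDimensional (L)ᵐᵒᵖ P := by
      rw [hP]
      exact FiniteDimensional.span_of_finite _ (Set.finite_range w)
    let f : P →ₗ[(L)ᵐᵒᵖ] P :=
      { toFun := fun p => ⟨x * p.1, hx p.1 p.2⟩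
        map_add' := fun a b => Subtype.ext (mul_add x a.1 b.1)
        map_smul' := fun c a => Subtype.ext (by
          change x * (a.1 * (c.unop : M)) = x * a.1 * (c.unop : M)
          rw [mul_assoc]) }
    have hinj : Function.Injective f := fun a b hab =>
      Subtype.ext (mul_left_cancel₀ hx0 (congrArg Subtype.val hab))
    have hsurj := LinearMap.injective_iff_surjective.mp hinj
    intro s hs
    obtain ⟨t, ht⟩ := hsurj ⟨s, hs⟩
    exact ⟨t.1, t.2, congrArg Subtype.val ht⟩
  refine ⟨fun s hs => by simpa using hs, fun x hx y hy s hs => ?_, fun x hx s hs => ?_,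
    fun x hx y hy s hs => ?_, fun x hx hx0 => ⟨fun s hs => ?_, ?_⟩⟩
  · rw [add_mul]
    exact hadd _ (hx s hs) _ (hy s hs)
  · rw [neg_mul]
    exact hneg _ (hx s hs)
  · rw [mul_assoc]
    exact hx _ (hy s hs)
  · obtain ⟨t, ht, rfl⟩ := key x hx hx0 s hs
    rwa [inv_mul_cancel_left₀ hx0]
  · ext s
    constructor
    · rintro ⟨t, ht, rfl⟩
      exact hx t ht
    · intro hs
      exact key x hx hx0 s hs
end

section
/- Let k be a field with char k ≠ 2 and let f ∈ k[u] be a monic polynomial of degree 3 whose roots (in an algebraic closure of k) are pairwise distinct. Let R = k[u,v]/(v² − f(u)), which is an integral domain under these hypotheses, and let F be its field of fractions (the function field of the affine plane cubic curve v² = f(u)). Then the kernel of the multiplication map F ⊗_k F → F, the k-algebra homomorphism determined by a ⊗ b ↦ ab, is not a principal ideal of the commutative ring F ⊗_k F; equivalently, the universal derivation bimodule Ω_k(F) is not cyclic as an F-bimodule. -/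
open TensorProduct

/-- The coordinate ring `k[u,v]/(v² − f(u))` of the affine plane curve
`v² = f(u)`, where `u = X 0` and `v = X 1`. -/
abbrev CubicCurveRing (k : Type*) [Field k] (f : Polynomial k) : Type _ :=
  MvPolynomial (Fin 2) k ⧸
    Ideal.span {MvPolynomial.X 1 ^ 2 -
      Polynomial.aeval (MvPolynomial.X 0 : MvPolynomial (Fin 2) k) f}

namespace EllKaehler

open scoped nonZeroDivisors

section ideals

variable {A : Type*} [CommRing A] [IsDomain A]

/-- An ideal dividing a nonzero principal ideal. -/
def Inv (P : Ideal A) : Prop := ∃ (Q : Ideal A) (a : A), a ≠ 0 ∧ P * Q = Ideal.span {a}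

lemma Inv.exists_eq_mul {P : Ideal A} (hP : Inv P) {J : Ideal A} (h : J ≤ P) :
    ∃ J₁, J = P * J₁ := by
  obtain ⟨Q, a, ha, hPQ⟩ := hP
  have h1 : J * Q ≤ Ideal.span {a} := hPQ ▸ Ideal.mul_mono_left h
  obtain ⟨J₁, hJ₁⟩ : ∃ J₁, J * Q = Ideal.span {a} * J₁ := by
    have : ((Ideal.span {a} : Ideal A)) ∣ J * Q := by
      refine ⟨Submodule.comap (LinearMap.mulLeft A a) (J * Q), ?_⟩
      rw [Ideal.eq_span_singleton_mul]
      refine ⟨fun z hz => ?_, fun z hz => by simpa using hz⟩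
      obtain ⟨c, rfl⟩ := Ideal.mem_span_singleton.mp (h1 hz)
      exact ⟨c, by simpa using hz, rfl⟩
    exact this
  refine ⟨J₁, (Ideal.span_singleton_mul_right_inj ha).mp ?_⟩
  calc Ideal.span {a} * J = P * (J * Q) := by rw [← hPQ]; ring
    _ = Ideal.span {a} * (P * J₁) := by rw [hJ₁]; ring

lemma Inv.cancel {P : Ideal A} (hP : Inv P) {J K : Ideal A} (h : P * J = P * K) : J = K := by
  obtain ⟨Q, a, ha, hPQ⟩ := hP
  refine (Ideal.span_singleton_mul_right_inj ha).mp ?_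
  rw [← hPQ, mul_comm P Q, mul_assoc, mul_assoc, h]

lemma inv_span {t : A} (ht : t ≠ 0) : Inv (Ideal.span {t}) := ⟨⊤, t, ht, Ideal.mul_top _⟩

variable (H : AddSubgroup (Additive (ClassGroup A)))

/-- The ideal is invertible, with class in `H`. -/
def ClassIn (I : Ideal A) : Prop :=
  ∃ U : (FractionalIdeal A⁰ (FractionRing A))ˣ,
    (U : FractionalIdeal A⁰ (FractionRing A)) = I ∧
      Additive.ofMul (ClassGroup.mk (FractionRing A) U) ∈ H

lemma classIn_top : ClassIn H ⊤ :=
  ⟨1, by simp, by rw [map_one]; exact H.zero_mem⟩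

lemma ClassIn.mul {I J : Ideal A} (hI : ClassIn H I) (hJ : ClassIn H J) : ClassIn H (I * J) := by
  obtain ⟨U, hU, hU'⟩ := hI
  obtain ⟨V, hV, hV'⟩ := hJ
  refine ⟨U * V, by rw [Units.val_mul, hU, hV, FractionalIdeal.coeIdeal_mul], ?_⟩
  rw [map_mul]
  exact H.add_mem hU' hV'

/-- All divisors of the ideal have class in `H`. -/
def Good (B : Ideal A) : Prop := ∀ J M : Ideal A, J * M = B → ClassIn H J

lemma good_top : Good H (⊤ : Ideal A) := by
  intro J M h
  have : J = ⊤ := top_le_iff.mp (h ▸ Ideal.mul_le_left)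
  exact this ▸ classIn_top H

lemma Good.mul {B P : Ideal A} (hB : Good H B) (hP : P.IsPrime) (hi : Inv P) (hc : ClassIn H P) :
    Good H (P * B) := by
  intro J M h
  have hle : J * M ≤ P := h ▸ Ideal.mul_le_left
  rcases hP.mul_le.mp hle with h1 | h1
  · obtain ⟨J₁, rfl⟩ := hi.exists_eq_mul h1
    exact hc.mul H (hB J₁ M (hi.cancel (by rw [← h, mul_assoc])))
  · obtain ⟨M₁, rfl⟩ := hi.exists_eq_mul h1
    exact hB J M₁ (hi.cancel (by rw [← h]; ring))

end ideals

section curve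

open WeierstrassCurve WeierstrassCurve.Affine Polynomial

variable {k : Type*} [Field k] {Ω : Type*} [Field Ω] [Algebra k Ω] [IsAlgClosed Ω]
  (W : WeierstrassCurve k)

lemma XYIdeal_isPrime {K : Type*} [Field K] {V : WeierstrassCurve.Affine K} {x y : K} (h : V.Equation x y) :
    (CoordinateRing.XYIdeal V x (C y)).IsPrime := by
  have e := CoordinateRing.quotientXYIdealEquiv (W' := V) (x := x) (y := C y) h
  rw [← Ideal.Quotient.isDomain_iff_prime]
  exact e.toMulEquiv.isDomain K

lemma XYIdeal_inv {K : Type*} [Field K] {V : WeierstrassCurve.Affine K} {x y : K} (h : V.Nonsingular x y) :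
    Inv (CoordinateRing.XYIdeal V x (C y)) := by
  refine ⟨CoordinateRing.XYIdeal V x (C (V.negY x y)), CoordinateRing.XClass V x,
    CoordinateRing.XClass_ne_zero x, ?_⟩
  rw [mul_comm, CoordinateRing.XYIdeal_neg_mul h]
  rfl

open Classical in
/-- classes of algebraic points -/
noncomputable def algClasses (Ω : Type*) [Field Ω] [Algebra k Ω] :
    AddSubgroup (Additive (ClassGroup (W⁄Ω).CoordinateRing)) :=
  ((Point.toClass (W := W⁄Ω)).comp
    (Point.map (W' := W) (IntermediateField.val (algebraicClosure k Ω)))).range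

lemma classIn_of_isAlgebraic {x y : Ω} (h : (W⁄Ω).Nonsingular x y) (hx : IsAlgebraic k x)
    (hy : IsAlgebraic k y) :
    ClassIn (algClasses W Ω) (CoordinateRing.XYIdeal (W⁄Ω) x (C y)) := by
  classical
  refine ⟨CoordinateRing.XYIdeal' (W := W⁄Ω) h, rfl, ?_⟩
  let x' : algebraicClosure k Ω := ⟨x, mem_algebraicClosure_iff.mpr hx⟩
  let y' : algebraicClosure k Ω := ⟨y, mem_algebraicClosure_iff.mpr hy⟩
  have h' : (W⁄(algebraicClosure k Ω)).Nonsingular x' y' :=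
    (WeierstrassCurve.Affine.baseChange_nonsingular (W := W) (f := IntermediateField.val (algebraicClosure k Ω))
      (RingHom.injective (IntermediateField.val (algebraicClosure k Ω)).toRingHom) x' y').mp h
  exact ⟨Point.some _ _ h', by rfl⟩

lemma isAlgebraic_of_eq {x y : Ω} (h : (W⁄Ω).Nonsingular x y)
    (hc : Additive.ofMul (ClassGroup.mk _ (CoordinateRing.XYIdeal' (W := W⁄Ω) h)) ∈
      algClasses W Ω) : IsAlgebraic k x := by
  classical
  obtain ⟨P, hP⟩ := hc
  have : Point.map (W' := W) (IntermediateField.val (algebraicClosure k Ω)) P = Point.some _ _ h :=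
    Point.toClass_injective hP
  rcases P with _ | ⟨a, b, hab⟩
  · cases this
  · rw [Point.map_some, Point.some.injEq] at this
    rw [← this.1]
    exact mem_algebraicClosure_iff.mp a.2

lemma good_XIdeal (hns : ∀ x y : Ω, (W⁄Ω).Equation x y → (W⁄Ω).Nonsingular x y)
    {x : Ω} (hx : IsAlgebraic k x) {B : Ideal (W⁄Ω).CoordinateRing}
    (hB : Good (algClasses W Ω) B) :
    Good (algClasses W Ω) (CoordinateRing.XIdeal (W⁄Ω) x * B) := by
  set K := algebraicClosure k Ω
  have hKint : IsAlgClosed K := (algebraicClosure.isAlgClosure k Ω).isAlgClosed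
  let x' : K := ⟨x, mem_algebraicClosure_iff.mpr hx⟩
  obtain ⟨y', hy'⟩ : ∃ y' : K, (W⁄K).Equation x' y' := by
    simp only [equation_iff']
    let p : K[X] := C 1 * X ^ 2 + C ((W⁄K).a₁ * x' + (W⁄K).a₃) * X +
      C (-(x' ^ 3 + (W⁄K).a₂ * x' ^ 2 + (W⁄K).a₄ * x' + (W⁄K).a₆))
    obtain ⟨y, hy⟩ := IsAlgClosed.exists_root p (by
      rw [degree_quadratic one_ne_zero]; decide)
    refine ⟨y, ?_⟩
    simp only [p, IsRoot.def, eval_add, eval_mul, eval_C, eval_pow, eval_X] at hy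
    linear_combination hy
  let y : Ω := (y' : Ω)
  have he : (W⁄Ω).Equation x y := (WeierstrassCurve.Affine.baseChange_equation (W := W) (f := IntermediateField.val K)
      (RingHom.injective (IntermediateField.val (algebraicClosure k Ω)).toRingHom) x' y').mpr hy'
  have hy : IsAlgebraic k y := mem_algebraicClosure_iff.mp y'.2
  have hn := hns x y he
  have hn' := (nonsingular_neg ..).mpr hn
  have hyn : IsAlgebraic k ((W⁄Ω).negY x y) := by
    have : ((W⁄Ω).negY x y) = ((W⁄K).negY x' y' : K) :=
      WeierstrassCurve.Affine.baseChange_negY (W' := W) (IntermediateField.val K) x' y'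
    rw [this]
    exact mem_algebraicClosure_iff.mp (SetLike.coe_mem _)
  rw [← CoordinateRing.XYIdeal_neg_mul hn, mul_assoc]
  exact ((hB.mul _ (XYIdeal_isPrime he) (XYIdeal_inv hn) (classIn_of_isAlgebraic W hn hx hy))).mul _
    (XYIdeal_isPrime hn'.1) (XYIdeal_inv hn') (classIn_of_isAlgebraic W hn' hx hyn)

lemma good_poly (hns : ∀ x y : Ω, (W⁄Ω).Equation x y → (W⁄Ω).Nonsingular x y)
    {N : k[X]} (hN : N ≠ 0) :
    Good (algClasses W Ω)
      (Ideal.span {CoordinateRing.mk (W⁄Ω) (C (N.map (algebraMap k Ω)))}) := by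
  have hs := (IsAlgClosed.splits (N.map (algebraMap k Ω))).eq_prod_roots
  have hr : ∀ x ∈ (N.map (algebraMap k Ω)).roots, IsAlgebraic k x := by
    intro x hx
    refine ⟨N, hN, ?_⟩
    have := (mem_roots'.mp hx).2
    rwa [IsRoot.def, eval_map_algebraMap] at this
  have hlc : (N.map (algebraMap k Ω)).leadingCoeff ≠ 0 := by
    simpa using hN
  generalize (N.map (algebraMap k Ω)).roots = S at hs hr
  rw [hs]
  clear hs
  induction S using Multiset.induction with
  | empty =>
    have : Ideal.span {CoordinateRing.mk (W⁄Ω) (C (C ((N.map (algebraMap k Ω)).leadingCoeff) *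
        (Multiset.map (fun a => X - C a) 0).prod))} = ⊤ := by
      rw [Ideal.span_singleton_eq_top, Multiset.map_zero, Multiset.prod_zero, mul_one]
      exact ((((isUnit_iff_ne_zero.mpr hlc).map (C : Ω →+* Polynomial Ω)).map
        (C : Polynomial Ω →+* Polynomial (Polynomial Ω))).map (CoordinateRing.mk (W⁄Ω)))
    rw [this]
    exact good_top _
  | cons a S ih =>
    have := good_XIdeal W hns (hr a (Multiset.mem_cons_self _ _))
      (ih fun x hx => hr x (Multiset.mem_cons_of_mem hx))
    rw [CoordinateRing.XIdeal, CoordinateRing.XClass, Ideal.span_singleton_mul_span_singleton,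
      ← map_mul, ← C_mul] at this
    rw [Multiset.map_cons, Multiset.prod_cons]
    convert this using 5
    ring

lemma exists_mul_eq_poly {R : Type*} [CommRing R] [IsDomain R] (V : WeierstrassCurve.Affine R)
    {s : V.CoordinateRing} (hs : s ≠ 0) :
    ∃ (s' : V.CoordinateRing) (N : R[X]), N ≠ 0 ∧ s * s' = CoordinateRing.mk V (C N) := by
  have hn : Algebra.norm R[X] s ≠ 0 := by
    rwa [Ne, Algebra.norm_eq_zero_iff_of_basis (CoordinateRing.basis V)]
  obtain ⟨p, q, rfl⟩ := CoordinateRing.exists_smul_basis_eq s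
  have := CoordinateRing.coe_norm_smul_basis (W' := V) p q
  rw [map_mul] at this
  refine ⟨CoordinateRing.mk V (C p + C q * (-X - C (C V.a₁ * X + C V.a₃))), _, hn, ?_⟩
  · refine Eq.trans ?_ this.symm
    congr 1
    simp only [CoordinateRing.smul, map_add, map_mul, mul_one]

/-- Base change of coordinate rings. -/
noncomputable def cmap (Ω : Type*) [Field Ω] [Algebra k Ω] :
    W.toAffine.CoordinateRing →+* (W⁄Ω).CoordinateRing :=
  CoordinateRing.map W.toAffine (algebraMap k Ω)

lemma cmap_injective : Function.Injective (cmap W Ω) :=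
  CoordinateRing.map_injective (algebraMap k Ω).injective

lemma cmap_mk (p) : cmap W Ω (CoordinateRing.mk W.toAffine p) =
    CoordinateRing.mk (W⁄Ω) (p.map (mapRingHom (algebraMap k Ω))) :=
  CoordinateRing.map_mk _ p

theorem isAlgebraic_main (hns : ∀ x y : Ω, (W⁄Ω).Equation x y → (W⁄Ω).Nonsingular x y)
    {x y : Ω} (h : (W⁄Ω).Equation x y) {s₀ : W.toAffine.CoordinateRing} (hs₀ : s₀ ≠ 0)
    {t : (W⁄Ω).CoordinateRing} (ht : t ∈ CoordinateRing.XYIdeal (W⁄Ω) x (C y))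
    (hX : t ∣ cmap W Ω s₀ * CoordinateRing.XClass (W⁄Ω) x)
    (hY : t ∣ cmap W Ω s₀ *
      CoordinateRing.YClass (W⁄Ω) (C y)) : IsAlgebraic k x := by
  set s := cmap W Ω s₀ with hsdef
  have hs : s ≠ 0 := by
    rw [hsdef, Ne, map_eq_zero_iff _ (cmap_injective W)]
    exact hs₀
  have hn := hns x y h
  have hinv := XYIdeal_inv hn
  have ht0 : t ≠ 0 := by
    rintro rfl
    exact mul_ne_zero hs (CoordinateRing.XClass_ne_zero x) (zero_dvd_iff.mp hX)
  obtain ⟨J, hJ⟩ := hinv.exists_eq_mul ((Ideal.span_singleton_le_iff_mem _).mpr ht)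
  obtain ⟨M, hM⟩ := (inv_span ht0).exists_eq_mul
    (J := Ideal.span {s} * CoordinateRing.XYIdeal (W⁄Ω) x (C y)) (by
      rw [CoordinateRing.XYIdeal, Ideal.span_mul_span', Ideal.span_le]
      rintro _ ⟨a, rfl, b, rfl | rfl, rfl⟩
      · exact Ideal.mem_span_singleton.mpr hX
      · exact Ideal.mem_span_singleton.mpr hY)
  have hJM : Ideal.span {s} = J * M := hinv.cancel (by rw [mul_comm, hM, hJ, mul_assoc])
  obtain ⟨s', N, hN, hsN⟩ := exists_mul_eq_poly W.toAffine hs₀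
  have hgood := good_poly W hns hN
  have hmap := congrArg (cmap W Ω) hsN
  rw [map_mul, ← hsdef, cmap_mk] at hmap
  obtain ⟨U, hU, hUc⟩ := hgood J (M * Ideal.span {cmap W Ω s'}) (by
    rw [← mul_assoc, ← hJM]
    refine (Ideal.span_singleton_mul_span_singleton _ _).trans ?_
    rw [hmap, Polynomial.map_C]
    rfl)
  have h1 : ClassGroup.mk _ (CoordinateRing.XYIdeal' (W := W⁄Ω) hn * U) = 1 := by
    refine (ClassGroup.mk_eq_one_of_coe_ideal (I' := Ideal.span {t}) ?_).mpr ⟨t, ht0, rfl⟩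
    rw [Units.val_mul, hU, hJ, FractionalIdeal.coeIdeal_mul]
    rfl
  rw [map_mul] at h1
  refine isAlgebraic_of_eq W hn ?_
  rw [eq_inv_of_mul_eq_one_left h1]
  exact (algClasses W Ω).neg_mem hUc

end curve
end EllKaehler
namespace EllKaehler

section tensor

variable {k R F Ω A : Type*} [Field k] [CommRing R] [IsDomain R] [Algebra k R] [Field F]
  [Algebra k F] [Algebra R F] [IsScalarTower k R F] [IsFractionRing R F]
  [Field Ω] [Algebra k Ω] [Algebra F Ω] [IsScalarTower k F Ω]
  [CommRing A] [IsDomain A] [Algebra k A] [Algebra Ω A] [IsScalarTower k Ω A]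

theorem exists_generator (ρ : R →ₐ[k] A) (hρ : Function.Injective ρ) (η : Ideal A)
    (hη : ∀ r : R, ρ r - algebraMap Ω A (algebraMap F Ω (algebraMap R F r)) ∈ η)
    (hI : (KaehlerDifferential.ideal k F).IsPrincipal) :
    ∃ t ∈ η, ∀ p q : R, ∃ s : R, s ≠ 0 ∧
      t ∣ ρ s * (ρ p - algebraMap Ω A (algebraMap F Ω (algebraMap R F p))) ∧
      t ∣ ρ s * (ρ q - algebraMap Ω A (algebraMap F Ω (algebraMap R F q))) := by
  let L := FractionRing A
  have hinj : Function.Injective (algebraMap A L) := IsFractionRing.injective A L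
  let c : F →ₐ[k] A := ((Algebra.ofId Ω A).restrictScalars k).comp (IsScalarTower.toAlgHom k F Ω)
  have hc : ∀ x, c x = algebraMap Ω A (algebraMap F Ω x) := fun x => rfl
  let ιL : F →ₐ[k] L := (IsScalarTower.toAlgHom k A L).comp c
  have hg : Function.Injective ((IsScalarTower.toAlgHom k A L).comp ρ) := by
    intro a b h
    exact hρ (hinj h)
  let ιR : F →ₐ[k] L := IsFractionRing.liftAlgHom hg
  have hιR : ∀ r : R, ιR (algebraMap R F r) = algebraMap A L (ρ r) := fun r =>
    IsFractionRing.lift_algebraMap hg r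
  let Φ : F ⊗[k] F →ₐ[k] L := Algebra.TensorProduct.lift ιL ιR (fun _ _ => Commute.all _ _)
  have hΦ : ∀ a b, Φ (a ⊗ₜ b) = ιL a * ιR b := fun a b => by simp [Φ]
  have key : ∀ x : F ⊗[k] F, ∃ (r : R) (a : A), r ≠ 0 ∧
      Φ x * algebraMap A L (ρ r) = algebraMap A L a ∧
      a - c (Algebra.TensorProduct.lmul' k x * algebraMap R F r) ∈ η := by
    intro x
    induction x using TensorProduct.induction_on with
    | zero => exact ⟨1, 0, one_ne_zero, by simp, by simp⟩
    | tmul b d =>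
      obtain ⟨p, q, hq, rfl⟩ := IsFractionRing.div_surjective (A := R) d
      have hq0 : q ≠ 0 := nonZeroDivisors.ne_zero hq
      have hqF : algebraMap R F q ≠ 0 := by
        rwa [Ne, map_eq_zero_iff _ (IsFractionRing.injective R F)]
      refine ⟨q, c b * ρ p, hq0, ?_, ?_⟩
      · rw [hΦ, ← hιR, mul_assoc, ← map_mul, div_mul_cancel₀ _ hqF, hιR, map_mul]
        rfl
      · rw [Algebra.TensorProduct.lmul'_apply_tmul, mul_assoc, div_mul_cancel₀ _ hqF, map_mul,
          ← mul_sub]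
        exact η.mul_mem_left _ (hη p)
    | add x y hx hy =>
      obtain ⟨r, a, hr, h1, h2⟩ := hx
      obtain ⟨r', a', hr', h1', h2'⟩ := hy
      refine ⟨r * r', a * ρ r' + a' * ρ r, mul_ne_zero hr hr', ?_, ?_⟩
      · simp only [map_add, map_mul]
        rw [← h1, ← h1']
        ring
      · have e : a * ρ r' + a' * ρ r -
            c (Algebra.TensorProduct.lmul' k (x + y) * algebraMap R F (r * r')) =
            ρ r' * (a - c (Algebra.TensorProduct.lmul' k x * algebraMap R F r)) +
            ρ r * (a' - c (Algebra.TensorProduct.lmul' k y * algebraMap R F r')) +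
            c (Algebra.TensorProduct.lmul' k x * algebraMap R F r) *
              (ρ r' - c (algebraMap R F r')) +
            c (Algebra.TensorProduct.lmul' k y * algebraMap R F r') *
              (ρ r - c (algebraMap R F r)) := by
          simp only [map_add, map_mul]
          ring
        rw [e]
        exact η.add_mem (η.add_mem (η.add_mem (η.mul_mem_left _ h2) (η.mul_mem_left _ h2'))
          (η.mul_mem_left _ (hη r'))) (η.mul_mem_left _ (hη r))
  obtain ⟨T, hT⟩ := hI
  have hTmem : T ∈ KaehlerDifferential.ideal k F := hT ▸ Submodule.mem_span_singleton_self T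
  obtain ⟨r, t, hr, h1, h2⟩ := key T
  have hT0 : Algebra.TensorProduct.lmul' k T = 0 := hTmem
  rw [hT0, zero_mul, map_zero, sub_zero] at h2
  have step : ∀ p : R, ∃ s : R, s ≠ 0 ∧ t ∣ ρ s * (ρ p - c (algebraMap R F p)) := by
    intro p
    have hm := KaehlerDifferential.one_smul_sub_smul_one_mem_ideal k (algebraMap R F p)
    rw [hT] at hm
    obtain ⟨x, hx⟩ := Submodule.mem_span_singleton.mp hm
    obtain ⟨r', a, hr', h1', -⟩ := key x
    refine ⟨r * r', mul_ne_zero hr hr', a, hinj ?_⟩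
    have := congrArg Φ hx
    rw [smul_eq_mul, map_mul, map_sub, hΦ, hΦ, map_one, map_one, one_mul, mul_one, hιR] at this
    rw [map_mul (algebraMap A L), map_sub, map_mul ρ, map_mul, map_mul (algebraMap A L), ← h1,
      ← h1']
    have e : ιL (algebraMap R F p) = algebraMap A L (c (algebraMap R F p)) := rfl
    rw [← e, ← this]
    ring
  refine ⟨t, h2, fun p q => ?_⟩
  obtain ⟨s, hs, h3⟩ := step p
  obtain ⟨s', hs', h4⟩ := step q
  refine ⟨s * s', mul_ne_zero hs hs', ?_, ?_⟩
  · rw [map_mul, mul_comm (ρ s), mul_assoc]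
    exact h3.mul_left _
  · rw [map_mul, mul_assoc]
    exact h4.mul_left _

end tensor

section cubic

open WeierstrassCurve WeierstrassCurve.Affine Polynomial

variable {k : Type*} [Field k] (f : Polynomial k)

/-- The Weierstrass curve `v² = f(u)`. -/
def wcurve : WeierstrassCurve k := ⟨0, f.coeff 2, 0, f.coeff 1, f.coeff 0⟩

lemma cubic_eq {f : Polynomial k} (hmonic : f.Monic) (hdeg : f.natDegree = 3) :
    f = X ^ 3 + C (f.coeff 2) * X ^ 2 + C (f.coeff 1) * X + C (f.coeff 0) := by
  have h3 : f.coeff 3 = 1 := by rw [← hdeg]; exact hmonic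
  conv_lhs => rw [f.as_sum_range, hdeg]
  simp only [Finset.sum_range_succ, Finset.sum_range_zero, h3, ← C_mul_X_pow_eq_monomial]
  simp
  ring

lemma wpoly {f : Polynomial k} (hmonic : f.Monic) (hdeg : f.natDegree = 3) :
    (wcurve f).toAffine.polynomial = X ^ 2 - C f := by
  conv_rhs => rw [cubic_eq hmonic hdeg]
  simp [wcurve, WeierstrassCurve.Affine.polynomial]

lemma mk_Y_sq {f : Polynomial k} (hmonic : f.Monic) (hdeg : f.natDegree = 3) :
    (CoordinateRing.mk (wcurve f).toAffine X) ^ 2 =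
      aeval (CoordinateRing.mk (wcurve f).toAffine (C X)) f := by
  have h2 : aeval (CoordinateRing.mk (wcurve f).toAffine (C X)) f =
      CoordinateRing.mk (wcurve f).toAffine (C (aeval (X : k[X]) f)) :=
    Polynomial.aeval_algHom_apply
      (IsScalarTower.toAlgHom k k[X] (wcurve f).toAffine.CoordinateRing) X f
  have e : CoordinateRing.mk (wcurve f).toAffine (wcurve f).toAffine.polynomial = 0 :=
    AdjoinRoot.mk_self
  have e' : CoordinateRing.mk (wcurve f).toAffine (X ^ 2 - C f) = 0 :=
    (congrArg (CoordinateRing.mk (wcurve f).toAffine) (wpoly hmonic hdeg)).symm.trans e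
  rw [map_sub, map_pow, sub_eq_zero] at e'
  rw [h2, e', aeval_X_left_apply]

/-- The comparison of coordinate rings. -/
noncomputable def phi (hmonic : f.Monic) (hdeg : f.natDegree = 3) :
    CubicCurveRing k f →ₐ[k] (wcurve f).toAffine.CoordinateRing :=
  Ideal.Quotient.liftₐ _ (MvPolynomial.aeval
    ![CoordinateRing.mk (wcurve f).toAffine (C X), CoordinateRing.mk (wcurve f).toAffine X]) (by
    intro a ha
    obtain ⟨b, rfl⟩ := Ideal.mem_span_singleton.mp ha
    rw [map_mul, map_sub, map_pow, MvPolynomial.aeval_X, ← Polynomial.aeval_algHom_apply,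
      MvPolynomial.aeval_X]
    simp only [Matrix.cons_val_zero, Matrix.cons_val_one]
    rw [mk_Y_sq hmonic hdeg, sub_self, zero_mul])

variable {f} (hmonic : f.Monic) (hdeg : f.natDegree = 3)

/-- class of the variable u -/
noncomputable def uu (f : Polynomial k) : CubicCurveRing k f :=
  Ideal.Quotient.mk _ (MvPolynomial.X 0)

/-- class of the variable v -/
noncomputable def vv (f : Polynomial k) : CubicCurveRing k f :=
  Ideal.Quotient.mk _ (MvPolynomial.X 1)

lemma phi_uu : phi f hmonic hdeg (uu f) = CoordinateRing.mk (wcurve f).toAffine (C X) := by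
  refine (Ideal.Quotient.lift_mk _ _ _).trans ?_
  simp

lemma phi_vv : phi f hmonic hdeg (vv f) = CoordinateRing.mk (wcurve f).toAffine X := by
  refine (Ideal.Quotient.lift_mk _ _ _).trans ?_
  simp

lemma vv_sq : (vv f) ^ 2 = aeval (uu f) f := by
  have h1 : aeval (uu f) f = Ideal.Quotient.mkₐ k (Ideal.span {MvPolynomial.X 1 ^ 2 -
      Polynomial.aeval (MvPolynomial.X 0 : MvPolynomial (Fin 2) k) f})
        (aeval (MvPolynomial.X 0) f) :=
    Polynomial.aeval_algHom_apply (Ideal.Quotient.mkₐ k (Ideal.span {MvPolynomial.X 1 ^ 2 -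
      Polynomial.aeval (MvPolynomial.X 0 : MvPolynomial (Fin 2) k) f})) (MvPolynomial.X 0) f
  rw [h1, vv, ← map_pow]
  exact Ideal.Quotient.eq.mpr (Ideal.subset_span rfl)

/-- inverse of `phi` -/
noncomputable def psi : (wcurve f).toAffine.CoordinateRing →+* CubicCurveRing k f :=
  AdjoinRoot.lift (aeval (uu f) : k[X] →ₐ[k] CubicCurveRing k f).toRingHom (vv f) (by
    rw [wpoly hmonic hdeg, eval₂_sub, eval₂_X_pow, eval₂_C, vv_sq]
    exact sub_self _)

lemma phi_injective {f : Polynomial k} (hmonic : f.Monic) (hdeg : f.natDegree = 3) :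
     Function.Injective (phi f hmonic hdeg) := by
  have : (psi hmonic hdeg).comp (phi f hmonic hdeg).toRingHom = RingHom.id _ := by
    apply Ideal.Quotient.ringHom_ext
    apply MvPolynomial.ringHom_ext
    · intro r
      have h1 : Ideal.Quotient.mk (Ideal.span {MvPolynomial.X 1 ^ 2 -
        Polynomial.aeval (MvPolynomial.X 0 : MvPolynomial (Fin 2) k) f}) (MvPolynomial.C r) =
          algebraMap k (CubicCurveRing k f) r := rfl
      have h2 : algebraMap k (wcurve f).toAffine.CoordinateRing r =
        AdjoinRoot.of _ (C r) := rfl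
      simp only [RingHom.comp_apply, RingHom.id_apply, h1]
      refine (congrArg (psi hmonic hdeg) ((phi f hmonic hdeg).commutes r)).trans ?_
      rw [h2, psi, AdjoinRoot.lift_of]
      exact aeval_C _ _
    · intro i
      fin_cases i
      · refine (congrArg (psi hmonic hdeg) (phi_uu hmonic hdeg)).trans ?_
        refine (AdjoinRoot.lift_of _).trans ?_
        exact aeval_X _
      · refine (congrArg (psi hmonic hdeg) (phi_vv hmonic hdeg)).trans ?_
        exact AdjoinRoot.lift_root _
  intro a b hab
  have h := fun x => DFunLike.congr_fun this x
  rw [← RingHom.id_apply a, ← RingHom.id_apply b, ← h a, ← h b]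
  exact congrArg (psi hmonic hdeg) hab

lemma isDomain_cubic {f : Polynomial k} (hmonic : f.Monic) (hdeg : f.natDegree = 3) : IsDomain (CubicCurveRing k f) :=
  (phi_injective hmonic hdeg).isDomain (phi f hmonic hdeg)

lemma nonsing {f : Polynomial k} (hmonic : f.Monic) (hdeg : f.natDegree = 3)
    (hchar : ringChar k ≠ 2) (hsep : f.Separable) {Ω : Type*} [Field Ω] [Algebra k Ω]
    (x y : Ω) (h : ((wcurve f)⁄Ω).Equation x y) : ((wcurve f)⁄Ω).Nonsingular x y := by
  rw [nonsingular_iff']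
  refine ⟨h, ?_⟩
  rw [equation_iff'] at h
  have h2 : (2 : Ω) ≠ 0 := by
    have : (2 : k) ≠ 0 := Ring.two_ne_zero hchar
    rw [← map_ofNat (algebraMap k Ω) 2]
    exact (map_ne_zero (algebraMap k Ω)).mpr this
  by_contra! hcon
  obtain ⟨a, b, hab⟩ := hsep
  have hab' := congrArg (aeval x) hab
  rw [map_add, map_mul, map_mul, map_one] at hab'
  have a1 : ((wcurve f)⁄Ω).a₁ = 0 := map_zero (algebraMap k Ω)
  have a3 : ((wcurve f)⁄Ω).a₃ = 0 := map_zero (algebraMap k Ω)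
  have a2 : ((wcurve f)⁄Ω).a₂ = algebraMap k Ω (f.coeff 2) := rfl
  have a4 : ((wcurve f)⁄Ω).a₄ = algebraMap k Ω (f.coeff 1) := rfl
  have a6 : ((wcurve f)⁄Ω).a₆ = algebraMap k Ω (f.coeff 0) := rfl
  rw [a1, a2, a3, a4, a6] at h
  rw [a1, a2, a3, a4] at hcon
  have hy : y = 0 := by
    have : 2 * y = 0 := by linear_combination hcon.2
    exact (mul_eq_zero.mp this).resolve_left h2
  have e1 : aeval x f = 0 := by
    have := congrArg (aeval x) (cubic_eq hmonic hdeg)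
    rw [this]
    simp only [map_add, map_mul, map_pow, aeval_X, aeval_C]
    rw [hy] at h
    linear_combination -h
  have e2 : aeval x (derivative f) = 0 := by
    have := congrArg (fun p => aeval x (derivative p)) (cubic_eq hmonic hdeg)
    refine this.trans ?_
    simp only [derivative_add, derivative_mul, derivative_C, derivative_X_pow, derivative_X]
    simp only [map_add, map_mul, map_pow, aeval_X, aeval_C]
    simp [map_ofNat (algebraMap k Ω)]
    linear_combination -hcon.1
  rw [e1, e2] at hab'
  simp at hab'

theorem not_principal {f : Polynomial k} (hmonic : f.Monic) (hdeg : f.natDegree = 3)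
    (hchar : ringChar k ≠ 2) (hsep : f.Separable)
    (F : Type) [Field F] [Algebra k F] [Algebra (CubicCurveRing k f) F]
    [IsScalarTower k (CubicCurveRing k f) F] [IsFractionRing (CubicCurveRing k f) F] :
    ¬ (KaehlerDifferential.ideal k F).IsPrincipal := by
  intro hI
  have hdom : IsDomain (CubicCurveRing k f) := isDomain_cubic hmonic hdeg
  let Ω := AlgebraicClosure F
  let W := wcurve f
  let g : CubicCurveRing k f →ₐ[k] Ω :=
    (IsScalarTower.toAlgHom k F Ω).comp (IsScalarTower.toAlgHom k (CubicCurveRing k f) F)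
  have hginj : Function.Injective g := fun a b h =>
    IsFractionRing.injective (CubicCurveRing k f) F ((algebraMap F Ω).injective h)
  let u : Ω := g (uu f)
  let v : Ω := g (vv f)
  have huv : v ^ 2 = aeval u f := by
    have := congrArg g (vv_sq (f := f))
    rw [map_pow, ← Polynomial.aeval_algHom_apply] at this
    exact this
  have heq : (W⁄Ω).Equation u v := by
    rw [equation_iff']
    have a1 : (W⁄Ω).a₁ = 0 := map_zero (algebraMap k Ω)
    have a3 : (W⁄Ω).a₃ = 0 := map_zero (algebraMap k Ω)
    have a2 : (W⁄Ω).a₂ = algebraMap k Ω (f.coeff 2) := rfl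
    have a4 : (W⁄Ω).a₄ = algebraMap k Ω (f.coeff 1) := rfl
    have a6 : (W⁄Ω).a₆ = algebraMap k Ω (f.coeff 0) := rfl
    rw [a1, a2, a3, a4, a6]
    have := congrArg (aeval u) (cubic_eq hmonic hdeg)
    rw [this] at huv
    simp only [map_add, map_mul, map_pow, aeval_X, aeval_C] at huv
    linear_combination huv
  have hcm : ∀ r : k, cmap W Ω (algebraMap k _ r) = algebraMap k (W⁄Ω).CoordinateRing r := by
    intro r
    have h1 : algebraMap k W.toAffine.CoordinateRing r =
      CoordinateRing.mk W.toAffine (C (C r)) := rfl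
    rw [h1, cmap_mk, Polynomial.map_C, coe_mapRingHom, Polynomial.map_C]
    rfl
  let cm : W.toAffine.CoordinateRing →ₐ[k] (W⁄Ω).CoordinateRing := { cmap W Ω with commutes' := hcm }
  let ρ : CubicCurveRing k f →ₐ[k] (W⁄Ω).CoordinateRing := cm.comp (phi f hmonic hdeg)
  have hρ : Function.Injective ρ := fun a b h =>
    phi_injective hmonic hdeg (cmap_injective W h)
  have hρu : ρ (uu f) - algebraMap Ω _ u = CoordinateRing.XClass (W⁄Ω) u := by
    have : ρ (uu f) = cmap W Ω (CoordinateRing.mk W.toAffine (C X)) :=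
      congrArg (cmap W Ω) (phi_uu hmonic hdeg)
    rw [this, cmap_mk, Polynomial.map_C, coe_mapRingHom, Polynomial.map_X,
      CoordinateRing.XClass, C_sub, map_sub]
    rfl
  have hρv : ρ (vv f) - algebraMap Ω _ v = CoordinateRing.YClass (W⁄Ω) (C v) := by
    have : ρ (vv f) = cmap W Ω (CoordinateRing.mk W.toAffine X) :=
      congrArg (cmap W Ω) (phi_vv hmonic hdeg)
    rw [this, cmap_mk, Polynomial.map_X, CoordinateRing.YClass, map_sub]
    rfl
  let η := CoordinateRing.XYIdeal (W⁄Ω) u (C v)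
  have hη : ∀ r, ρ r - algebraMap Ω (W⁄Ω).CoordinateRing (g r) ∈ η := by
    intro r
    let m := Ideal.Quotient.mkₐ k η
    have hEq : m.comp ρ = m.comp (((Algebra.ofId Ω _).restrictScalars k).comp g) := by
      apply Ideal.Quotient.algHom_ext
      apply MvPolynomial.algHom_ext
      intro i
      fin_cases i
      · refine Ideal.Quotient.eq.mpr ?_
        have : ρ (uu f) - algebraMap Ω _ u ∈ η := by
          rw [hρu]
          exact Ideal.subset_span (Set.mem_insert _ _)
        exact this
      · refine Ideal.Quotient.eq.mpr ?_
        have : ρ (vv f) - algebraMap Ω _ v ∈ η := by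
          rw [hρv]
          exact Ideal.subset_span (Set.mem_insert_of_mem _ rfl)
        exact this
    exact Ideal.Quotient.eq.mp (DFunLike.congr_fun hEq r)
  obtain ⟨t, ht, hpq⟩ := exists_generator (F := F) (Ω := Ω) ρ hρ η hη hI
  obtain ⟨s, hs, h1, h2⟩ := hpq (uu f) (vv f)
  have hs' : phi f hmonic hdeg s ≠ 0 := by
    rwa [Ne, map_eq_zero_iff _ (phi_injective hmonic hdeg)]
  have halg : IsAlgebraic k u := by
    refine isAlgebraic_main W (nonsing hmonic hdeg hchar hsep) heq hs' ht ?_ ?_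
    · rw [← hρu]; exact h1
    · rw [← hρv]; exact h2
  obtain ⟨p, hp, hpu⟩ := halg
  apply hp
  have h3 : aeval (uu f) p = 0 := hginj (by
    rw [← Polynomial.aeval_algHom_apply, map_zero]; exact hpu)
  have h4 := congrArg (phi f hmonic hdeg) h3
  rw [← Polynomial.aeval_algHom_apply, phi_uu, map_zero] at h4
  have h5 : aeval (CoordinateRing.mk (wcurve f).toAffine (C X)) p =
      algebraMap k[X] (wcurve f).toAffine.CoordinateRing (aeval (X : k[X]) p) :=
    Polynomial.aeval_algHom_apply
      (IsScalarTower.toAlgHom k k[X] (wcurve f).toAffine.CoordinateRing) X p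
  rw [h5, aeval_X_left_apply] at h4
  exact (FaithfulSMul.algebraMap_injective k[X] (wcurve f).toAffine.CoordinateRing)
    (h4.trans (map_zero _).symm)

end cubic
end EllKaehler
/-- **Theorem (the universal derivation bimodule of an elliptic function field is
not cyclic).**
Let `char k ≠ 2` and let `f ∈ k[u]` be a monic cubic polynomial with pairwise
distinct roots (i.e. separable). Then `R = k[u,v]/(v² − f(u))` is an integral
domain and, for its field of fractions `F`, the kernel of the multiplication map
`F ⊗_k F → F` (the universal derivation bimodule `Ω_k(F)`) is not a principal
ideal of `F ⊗_k F`. -/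
theorem elliptic_function_field_kaehler_ideal_not_principal
    (k : Type*) [Field k] (hchar : ringChar k ≠ 2)
    (f : Polynomial k) (hmonic : f.Monic) (hdeg : f.natDegree = 3)
    (hsep : f.Separable) :
    IsDomain (CubicCurveRing k f) ∧
    ∀ (F : Type) [Field F] [Algebra k F] [Algebra (CubicCurveRing k f) F]
      [IsScalarTower k (CubicCurveRing k f) F] [IsFractionRing (CubicCurveRing k f) F],
      ¬ (KaehlerDifferential.ideal k F).IsPrincipal := by
  exact ⟨EllKaehler.isDomain_cubic hmonic hdeg, fun F => EllKaehler.not_principal hmonic hdeg hchar hsep F⟩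
end

section
/- Let M be a skew field that is a k-algebra whose center equals exactly the image of k, and assume that every element of M that is algebraic over k lies in (the image of) k. Then every inner automorphism of M of finite order is the identity; consequently, for every finite group G of k-algebra automorphisms of M, the identity is the only element of G acting as an inner automorphism. -/
/-- **Lemma (free-skew-field-like skew fields have no nontrivial inner
automorphisms of finite order).**
Let `M` be a skew field and a `k`-algebra whose center is exactly the image of
`k`, and such that every element of `M` algebraic over `k` lies in the image of
`k`. Then every inner automorphism of `M` of finite order is the identity;
consequently, for every finite group `G` of `k`-algebra automorphisms of `M`, the
identity is the only element of `G` acting as an inner automorphism. -/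
theorem inner_automorphism_of_finite_order_is_id
    (k M : Type*) [Field k] [DivisionRing M] [Algebra k M]
    (hcenter : (Subring.center M : Set M) = Set.range (algebraMap k M))
    (halg : ∀ x : M, IsAlgebraic k x → x ∈ Set.range (algebraMap k M)) :
    (∀ u : M, u ≠ 0 → ∀ n : ℕ, 0 < n →
      (∀ a : M, (fun a : M => u * a * u⁻¹)^[n] a = a) → ∀ a : M, u * a * u⁻¹ = a) ∧
    (∀ (G : Type) (_ : Group G) (_ : Finite G) (φ : G →* (M ≃ₐ[k] M)),
      Function.Injective φ →
      ∀ (g : G) (u : M), u ≠ 0 → (∀ a : M, φ g a = u * a * u⁻¹) → g = 1) := by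
  have key : ∀ u : M, u ≠ 0 → ∀ n : ℕ, 0 < n →
      (∀ a : M, (fun a : M => u * a * u⁻¹)^[n] a = a) → ∀ a : M, u * a * u⁻¹ = a := by
    intro u hu n hn h a
    have hit : ∀ (m : ℕ) (b : M), (fun a : M => u * a * u⁻¹)^[m] b * u ^ m = u ^ m * b := by
      intro m
      induction m with
      | zero => intro b; simp
      | succ m ih =>
        intro b
        rw [Function.iterate_succ_apply, pow_succ, ← mul_assoc, ih]
        simp only [mul_assoc]
        rw [inv_mul_cancel₀ hu, mul_one]
    have hc : u ^ n ∈ (Subring.center M : Set M) := by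
      rw [SetLike.mem_coe, Subring.mem_center_iff]
      intro b
      rw [← hit n b, h b]
    rw [hcenter] at hc
    obtain ⟨c, hc⟩ := hc
    have hal : IsAlgebraic k u := by
      refine ⟨Polynomial.X ^ n - Polynomial.C c, Polynomial.X_pow_sub_C_ne_zero hn c, ?_⟩
      simp [hc]
    obtain ⟨d, rfl⟩ := halg u hal
    rw [Algebra.commutes, mul_assoc, mul_inv_cancel₀ hu, mul_one]
  refine ⟨key, ?_⟩
  intro G _ _ φ hφ g u hu hg
  apply hφ
  rw [map_one]
  ext a
  rw [hg a, AlgEquiv.one_apply]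
  refine key u hu (orderOf g) (orderOf_pos g) ?_ a
  have hfun : (fun a : M => u * a * u⁻¹) = φ g := by
    funext b
    exact (hg b).symm
  intro b
  have hp : ∀ m : ℕ, (φ g)^[m] b = φ (g ^ m) b := by
    intro m
    induction m with
    | zero => simp
    | succ m ih =>
      rw [Function.iterate_succ_apply', ih, pow_succ', map_mul, AlgEquiv.mul_apply]
  rw [hfun, hp, pow_orderOf_eq_one, map_one, AlgEquiv.one_apply]
end
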